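/- arXiv:2504.14263 — 11 statements merged into one kernel-verified Lean document; each statement's English description precedes it below -/
import Mathlib

section
/- Let (X,d) be a nonempty complete metric space and let α₁, α₂ : X → X be injective contractions with ratios c₁, c₂ ∈ (0,1) respectively. Suppose that the (unique) fixed points of α₁ and α₂ are distinct and that c₁ + c₂ ≤ 1. Then the semigroup of maps generated by α₁ and α₂ under composition is free of rank 2, i.e., any two distinct nonempty finite words in α₁, α₂ define distinct maps X → X. -/
/-- Evaluation of a word. -/
def evw {X : Type*} (f : Bool → X → X) (w : List Bool) : X → X :=
  (w.map f).foldr (· ∘ ·) id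

theorem evw_nil {X : Type*} (f : Bool → X → X) (x : X) : evw f [] x = x := rfl

theorem evw_cons {X : Type*} (f : Bool → X → X) (b : Bool) (w : List Bool) (x : X) :
    evw f (b :: w) x = f b (evw f w x) := rfl

theorem evw_mem {X : Type*} (f : Bool → X → X) (S : Set X)
    (hS : ∀ b, ∀ x ∈ S, f b x ∈ S) (w : List Bool) : ∀ x ∈ S, evw f w x ∈ S := by
  induction w with
  | nil => intro x hx; exact hx
  | cons b w ih => intro x hx; exact hS b _ (ih x hx)

/-- No point of `S` is almost extremal from all points of `w(S)`. -/
theorem no_far {X : Type*} [MetricSpace X] (f : Bool → X → X) (c : Bool → ℝ)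
    (hc0 : ∀ b, 0 < c b) (hc1 : ∀ b, c b < 1) (hsum : ∀ b, c b + c (!b) ≤ 1)
    (hf : ∀ b x y, dist (f b x) (f b y) ≤ c b * dist x y)
    (S : Set X) (hS : ∀ b, ∀ x ∈ S, f b x ∈ S)
    (hS2 : ∀ x ∈ S, ∃ b, ∃ y ∈ S, f b y = x)
    (D : ℝ) (hD : 0 < D) (hSD : ∀ x ∈ S, ∀ y ∈ S, dist x y ≤ D)
    (hz : ∃ z : Bool → X, (∀ b, z b ∈ S) ∧ ∀ b, f b (z b) = f (!b) (z (!b)))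
    (hne : S.Nonempty) (w : List Bool) :
    ∃ ε > 0, ∀ x ∈ S, ∃ t ∈ S, dist x (evw f w t) ≤ D - ε := by
  obtain ⟨z, hzS, hz⟩ := hz
  obtain ⟨s, hs⟩ := hne
  induction w with
  | nil => exact ⟨D, hD, fun x hx => ⟨x, hx, by simp [evw_nil]⟩⟩
  | cons i w ih =>
    obtain ⟨ε, hε, h⟩ := ih
    refine ⟨min ((1 - c i) * D) (c i * ε),
      lt_min (mul_pos (by linarith [hc1 i]) hD) (mul_pos (hc0 i) hε), ?_⟩
    intro x hx
    obtain ⟨b, y, hy, rfl⟩ := hS2 x hx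
    by_cases hb : b = i
    · subst hb
      refine ⟨s, hs, ?_⟩
      have h1 := hf b y (evw f w s)
      have h2 := mul_le_mul_of_nonneg_left (hSD y hy _ (evw_mem f S hS w s hs)) (hc0 b).le
      have h3 := min_le_left ((1 - c b) * D) (c b * ε)
      rw [evw_cons]
      linarith
    · have hb' : b = !i := by cases b <;> cases i <;> simp_all
      subst hb'
      obtain ⟨t, ht, h0⟩ := h (z i) (hzS i)
      refine ⟨t, ht, ?_⟩
      rw [evw_cons]
      have h1 := hf (!i) y (z (!i))
      have h2 := mul_le_mul_of_nonneg_left (hSD y hy _ (hzS (!i))) (hc0 (!i)).le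
      have h3 := min_le_right ((1 - c i) * D) (c i * ε)
      have h4 := hf i (z i) (evw f w t)
      have h5 := mul_le_mul_of_nonneg_left h0 (hc0 i).le
      have h6 := dist_triangle (f (!i) y) (f i (z i)) (f i (evw f w t))
      rw [← hz i] at h1
      have h7 := mul_le_mul_of_nonneg_right (hsum i) hD.le
      linarith

/-- Words with different first letters give different maps. -/
theorem first_letter {X : Type*} [MetricSpace X] (f : Bool → X → X) (c : Bool → ℝ)
    (hc0 : ∀ b, 0 < c b) (hc1 : ∀ b, c b < 1) (hsum : ∀ b, c b + c (!b) ≤ 1)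
    (hf : ∀ b x y, dist (f b x) (f b y) ≤ c b * dist x y)
    (S : Set X) (hS : ∀ b, ∀ x ∈ S, f b x ∈ S)
    (hS2 : ∀ x ∈ S, ∃ b, ∃ y ∈ S, f b y = x)
    (D : ℝ) (hD : 0 < D) (hSD : ∀ x ∈ S, ∀ y ∈ S, dist x y ≤ D)
    (hap : ∀ ε > 0, ∃ x ∈ S, ∃ y ∈ S, D - ε < dist x y)
    (hne : S.Nonempty) (u v : List Bool)
    (huv : ∀ t, f true (evw f u t) = f false (evw f v t)) : False := by
  obtain ⟨s, hs⟩ := hne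
  obtain ⟨ε, hε, h⟩ := no_far f c hc0 hc1 hsum hf S hS hS2 D hD hSD
    ⟨fun b => if b then evw f u s else evw f v s, by
      intro b; cases b
      · exact evw_mem f S hS v s hs
      · exact evw_mem f S hS u s hs, by
      intro b; cases b
      · exact (huv s).symm
      · exact huv s⟩ ⟨s, hs⟩ u
  obtain ⟨x, hx, y, hy, hxy⟩ := hap
    (min (c true * ε) (min ((1 - c true) * D) ((1 - c false) * D)))
    (lt_min (mul_pos (hc0 _) hε) (lt_min (mul_pos (by linarith [hc1 true]) hD)
      (mul_pos (by linarith [hc1 false]) hD)))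
  have m1 := min_le_left (c true * ε) (min ((1 - c true) * D) ((1 - c false) * D))
  have m2 := min_le_right (c true * ε) (min ((1 - c true) * D) ((1 - c false) * D))
  have m3 := min_le_left ((1 - c true) * D) ((1 - c false) * D)
  have m4 := min_le_right ((1 - c true) * D) ((1 - c false) * D)
  have key : ∀ x' ∈ S, ∀ y' ∈ S, dist (f true x') (f false y') ≤ D - c true * ε := by
    intro x' hx' y' hy'
    obtain ⟨t, ht, h0⟩ := h x' hx'
    have h1 := hf true x' (evw f u t)
    have h2 := mul_le_mul_of_nonneg_left h0 (hc0 true).le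
    have h3 := hf false (evw f v t) y'
    have h4 := mul_le_mul_of_nonneg_left
      (hSD _ (evw_mem f S hS v t ht) y' hy') (hc0 false).le
    have h6 := dist_triangle (f true x') (f true (evw f u t)) (f false y')
    rw [huv t] at h6 h1
    have h7 := mul_le_mul_of_nonneg_right (hsum true) hD.le
    simp only [Bool.not_true] at h7
    linarith
  obtain ⟨b, x', hx', rfl⟩ := hS2 x hx
  obtain ⟨b', y', hy', rfl⟩ := hS2 y hy
  have hg := hf b x' y'
  have hg2 := mul_le_mul_of_nonneg_left (hSD x' hx' y' hy') (hc0 b).le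
  cases b <;> cases b'
  · linarith
  · have := key y' hy' x' hx'
    rw [dist_comm] at this
    linarith
  · have := key x' hx' y' hy'
    linarith
  · linarith

theorem exists_fix {X : Type*} [MetricSpace X] [Nonempty X] [CompleteSpace X]
    (g : X → X) (c : ℝ) (h0 : 0 < c) (h1 : c < 1)
    (hg : ∀ x y, dist (g x) (g y) ≤ c * dist x y) : ∃ p, g p = p := by
  have : ContractingWith ⟨c, h0.le⟩ g :=
    ⟨by exact_mod_cast h1, LipschitzWith.of_dist_le_mul hg⟩
  exact ⟨_, this.fixedPoint_isFixedPt⟩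

theorem evw_free {X : Type*} [MetricSpace X] [Nonempty X] [CompleteSpace X]
    (f : Bool → X → X) (c : Bool → ℝ)
    (hc0 : ∀ b, 0 < c b) (hc1 : ∀ b, c b < 1) (hsum : ∀ b, c b + c (!b) ≤ 1)
    (hf : ∀ b x y, dist (f b x) (f b y) ≤ c b * dist x y)
    (hinj : ∀ b, Function.Injective (f b))
    (hfix : ∀ p q : X, f true p = p → f false q = q → p ≠ q) :
    ∀ w₁ w₂ : List Bool, (∀ t, evw f w₁ t = evw f w₂ t) → w₁ = w₂ := by
  obtain ⟨p, hp⟩ := exists_fix (f true) _ (hc0 _) (hc1 _) (hf true)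
  obtain ⟨q, hq⟩ := exists_fix (f false) _ (hc0 _) (hc1 _) (hf false)
  have hpq := hfix p q hp hq
  have hd : 0 < dist p q := dist_pos.mpr hpq
  let S : Set X := {x | ∃ w, x = evw f w p ∨ x = evw f w q}
  have hpS : p ∈ S := ⟨[], Or.inl rfl⟩
  have hqS : q ∈ S := ⟨[], Or.inr rfl⟩
  have hS : ∀ b, ∀ x ∈ S, f b x ∈ S := by
    rintro b x ⟨w, rfl | rfl⟩
    · exact ⟨b :: w, Or.inl rfl⟩
    · exact ⟨b :: w, Or.inr rfl⟩
  have hS2 : ∀ x ∈ S, ∃ b, ∃ y ∈ S, f b y = x := by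
    rintro x ⟨w, rfl | rfl⟩
    · cases w with
      | nil => exact ⟨true, p, hpS, hp⟩
      | cons b w => exact ⟨b, evw f w p, ⟨w, Or.inl rfl⟩, rfl⟩
    · cases w with
      | nil => exact ⟨false, q, hqS, hq⟩
      | cons b w => exact ⟨b, evw f w q, ⟨w, Or.inr rfl⟩, rfl⟩
  obtain ⟨R, hR1, hR2, hR0⟩ : ∃ R, dist q p ≤ R ∧ dist (f false p) p ≤ (1 - c false) * R ∧
      0 ≤ R := by
    have hpos : 0 < 1 - c false := by linarith [hc1 false]
    refine ⟨max (dist q p) (dist (f false p) p / (1 - c false)), le_max_left _ _, ?_,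
      le_max_of_le_left dist_nonneg⟩
    have := le_max_right (dist q p) (dist (f false p) p / (1 - c false))
    rw [div_le_iff₀ hpos] at this
    linarith
  have hstep : ∀ b x, dist x p ≤ R → dist (f b x) p ≤ R := by
    intro b x hx
    have h1 := hf b x p
    have h2 := mul_le_mul_of_nonneg_left hx (hc0 b).le
    cases b
    · have := dist_triangle (f false x) (f false p) p
      linarith
    · rw [hp] at h1
      have := mul_le_mul_of_nonneg_right (hc1 true).le hR0
      linarith
  have hB := evw_mem f {x | dist x p ≤ R} hstep
  have hSR : ∀ x ∈ S, dist x p ≤ R := by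
    rintro x ⟨w, rfl | rfl⟩
    · exact hB w p (by simpa using hR0)
    · exact hB w q hR1
  let T : Set ℝ := {r | ∃ x ∈ S, ∃ y ∈ S, r = dist x y}
  have hT : BddAbove T := by
    refine ⟨R + R, ?_⟩
    rintro r ⟨x, hx, y, hy, rfl⟩
    have := dist_triangle_right x y p
    linarith [hSR x hx, hSR y hy]
  have hSD : ∀ x ∈ S, ∀ y ∈ S, dist x y ≤ sSup T :=
    fun x hx y hy => le_csSup hT ⟨x, hx, y, hy, rfl⟩
  have hD : 0 < sSup T := hd.trans_le (hSD p hpS q hqS)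
  have hap : ∀ ε > 0, ∃ x ∈ S, ∃ y ∈ S, sSup T - ε < dist x y := by
    intro ε hε
    obtain ⟨r, ⟨x, hx, y, hy, rfl⟩, h⟩ := exists_lt_of_lt_csSup
      (⟨_, p, hpS, q, hqS, rfl⟩ : T.Nonempty) (show sSup T - ε < sSup T by linarith)
    exact ⟨x, hx, y, hy, h⟩
  have hfl := first_letter f c hc0 hc1 hsum hf S hS hS2 _ hD hSD hap ⟨p, hpS⟩
  -- nonempty words do not act as the identity
  have hshort : ∀ w x y, dist (evw f w x) (evw f w y) ≤ dist x y := by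
    intro w x y
    induction w with
    | nil => exact le_rfl
    | cons b w ih =>
      have h1 := hf b (evw f w x) (evw f w y)
      have h2 := mul_le_mul_of_nonneg_right (hc1 b).le
        (dist_nonneg (x := evw f w x) (y := evw f w y))
      rw [evw_cons, evw_cons]
      linarith
  have hid : ∀ b w, ¬ ∀ t, evw f (b :: w) t = t := by
    intro b w h
    have h1 := hf b (evw f w p) (evw f w q)
    rw [← evw_cons f b w p, ← evw_cons f b w q, h, h] at h1
    have h2 := mul_le_mul_of_nonneg_left (hshort w p q) (hc0 b).le
    have h3 := mul_lt_mul_of_pos_right (hc1 b) hd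
    linarith
  intro w₁
  induction w₁ with
  | nil =>
    intro w₂ h
    cases w₂ with
    | nil => rfl
    | cons b w => exact (hid b w fun t => (h t).symm).elim
  | cons a u ih =>
    intro w₂ h
    cases w₂ with
    | nil => exact (hid a u h).elim
    | cons b v =>
      by_cases hab : a = b
      · subst hab
        rw [ih v fun t => hinj a (h t)]
      · exfalso
        cases a <;> cases b
        · exact hab rfl
        · exact hfl v u fun t => (h t).symm
        · exact hfl u v h
        · exact hab rfl

/-- The ping-pong proposition for contractions: two injective contractions with
distinct fixed points and ratios summing to at most 1 generate a free semigroup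
of rank 2.  Nonempty words in the two-letter alphabet are encoded as nonempty
lists of booleans, and evaluated to self-maps of `X` by composition. -/
theorem stmt_0 {X : Type*} [MetricSpace X] [Nonempty X] [CompleteSpace X]
    (α₁ α₂ : X → X) (c₁ c₂ : ℝ)
    (hc₁ : c₁ ∈ Set.Ioo (0 : ℝ) 1) (hc₂ : c₂ ∈ Set.Ioo (0 : ℝ) 1)
    (hcontr₁ : ∀ x y : X, dist (α₁ x) (α₁ y) ≤ c₁ * dist x y)
    (hcontr₂ : ∀ x y : X, dist (α₂ x) (α₂ y) ≤ c₂ * dist x y)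
    (hinj₁ : Function.Injective α₁) (hinj₂ : Function.Injective α₂)
    (hfix : ∀ p q : X, α₁ p = p → α₂ q = q → p ≠ q)
    (hsum : c₁ + c₂ ≤ 1) :
    ∀ w₁ w₂ : List Bool, w₁ ≠ [] → w₂ ≠ [] →
      (w₁.map fun b => if b then α₁ else α₂).foldr (· ∘ ·) id =
        (w₂.map fun b => if b then α₁ else α₂).foldr (· ∘ ·) id →
      w₁ = w₂ := by
  intro w₁ w₂ _ _ h
  refine evw_free (fun b => if b then α₁ else α₂) (fun b => if b then c₁ else c₂)
    ?_ ?_ ?_ ?_ ?_ ?_ w₁ w₂ (fun t => congrFun h t)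
  · intro b; cases b
    · exact hc₂.1
    · exact hc₁.1
  · intro b; cases b
    · exact hc₂.2
    · exact hc₁.2
  · intro b; cases b
    · simpa [add_comm] using hsum
    · simpa using hsum
  · intro b; cases b
    · exact hcontr₂
    · exact hcontr₁
  · intro b; cases b
    · exact hinj₂
    · exact hinj₁
  · intro p q hp hq
    exact hfix p q hp hq
end

section
/- Let (X,d) be a nonempty complete metric space, let α₁, α₂ : X → X be contractions with ratios c₁, c₂ ∈ (0,1), and let A ⊆ X be a nonempty compact set satisfying A = α₁(A) ∪ α₂(A). If A is disconnected (i.e., not connected as a topological subspace), then α₁(A) ∩ α₂(A) = ∅. -/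
/-- Chain connectedness at scale `ε`, phrased with invariant sets. -/
def ChainConn {X : Type*} [MetricSpace X] (A : Set X) (ε : ℝ) : Prop :=
  ∀ S : Set X, (∃ x ∈ A, x ∈ S) → (∀ u ∈ A, u ∈ S → ∀ v ∈ A, dist u v ≤ ε → v ∈ S) → A ⊆ S

theorem chainConn_image {X : Type*} [MetricSpace X] {A : Set X} {ε c : ℝ} (α : X → X)
    (hc : 0 ≤ c) (h : ∀ x y : X, dist (α x) (α y) ≤ c * dist x y) (hα : ∀ a ∈ A, α a ∈ A)
    (hA : ChainConn A ε) (S : Set X) (hx : ∃ x ∈ α '' A, x ∈ S)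
    (hS : ∀ u ∈ A, u ∈ S → ∀ v ∈ A, dist u v ≤ c * ε → v ∈ S) : α '' A ⊆ S := by
  obtain ⟨_, ⟨a, ha, rfl⟩, haS⟩ := hx
  rintro _ ⟨b, hb, rfl⟩
  refine hA (α ⁻¹' S) ⟨a, ha, haS⟩ ?_ hb
  intro u hu huS v hv huv
  exact hS _ (hα u hu) huS _ (hα v hv) ((h u v).trans (mul_le_mul_of_nonneg_left huv hc))

/-- If the attractor `A` of a system of two contractions is disconnected,
then the two images `α₁(A)` and `α₂(A)` are disjoint. -/
theorem stmt_1 {X : Type*} [MetricSpace X] [Nonempty X] [CompleteSpace X]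
    (α₁ α₂ : X → X) (c₁ c₂ : ℝ)
    (hc₁ : c₁ ∈ Set.Ioo (0 : ℝ) 1) (hc₂ : c₂ ∈ Set.Ioo (0 : ℝ) 1)
    (hcontr₁ : ∀ x y : X, dist (α₁ x) (α₁ y) ≤ c₁ * dist x y)
    (hcontr₂ : ∀ x y : X, dist (α₂ x) (α₂ y) ≤ c₂ * dist x y)
    (A : Set X) (hA : A.Nonempty) (hAc : IsCompact A)
    (hself : A = α₁ '' A ∪ α₂ '' A)
    (hdisc : ¬ IsConnected A) :
    (α₁ '' A) ∩ (α₂ '' A) = ∅ := by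
  by_contra hne
  apply hdisc
  obtain ⟨p, hp1, hp2⟩ := Set.nonempty_iff_ne_empty.mpr hne
  have hm1 : ∀ a ∈ A, α₁ a ∈ A := fun a ha => by
    rw [hself]; exact Or.inl ⟨a, ha, rfl⟩
  have hm2 : ∀ a ∈ A, α₂ a ∈ A := fun a ha => by
    rw [hself]; exact Or.inr ⟨a, ha, rfl⟩
  obtain ⟨c, hc0, hc1, h1, h2⟩ : ∃ c : ℝ, 0 ≤ c ∧ c < 1 ∧
      (∀ x y : X, dist (α₁ x) (α₁ y) ≤ c * dist x y) ∧
      (∀ x y : X, dist (α₂ x) (α₂ y) ≤ c * dist x y) := by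
    refine ⟨max c₁ c₂, hc₁.1.le.trans (le_max_left _ _), max_lt hc₁.2 hc₂.2, ?_, ?_⟩
    · intro x y
      exact (hcontr₁ x y).trans (mul_le_mul_of_nonneg_right (le_max_left _ _) dist_nonneg)
    · intro x y
      exact (hcontr₂ x y).trans (mul_le_mul_of_nonneg_right (le_max_right _ _) dist_nonneg)
  have hchain : ∀ n : ℕ, ChainConn A (c ^ n * Metric.diam A) := by
    intro n
    induction n with
    | zero =>
      rintro S ⟨x, hx, hxS⟩ hS v hv
      refine hS x hx hxS v hv ?_
      rw [pow_zero, one_mul]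
      exact Metric.dist_le_diam_of_mem hAc.isBounded hx hv
    | succ n ih =>
      intro S hx hS
      rw [pow_succ', mul_assoc] at hS
      have i1 := fun h => chainConn_image α₁ hc0 h1 hm1 ih S h hS
      have i2 := fun h => chainConn_image α₂ hc0 h2 hm2 ih S h hS
      have hpS : p ∈ S := by
        obtain ⟨x, hx, hxS⟩ := hx
        rw [hself] at hx
        rcases hx with hx | hx
        · exact i1 ⟨x, hx, hxS⟩ hp1
        · exact i2 ⟨x, hx, hxS⟩ hp2
      rw [hself]
      exact Set.union_subset (i1 ⟨p, hp1, hpS⟩) (i2 ⟨p, hp2, hpS⟩)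
  refine ⟨hA, ?_⟩
  rw [isPreconnected_closed_iff]
  intro t t' ht ht' hcov ⟨x, hxA, hxt⟩ ⟨y, hyA, hyt⟩
  by_contra hemp
  have hdisj : Disjoint (A ∩ t) (A ∩ t') := by
    rw [Set.disjoint_left]
    intro z hz hz'
    exact hemp ⟨z, hz.1, hz.2, hz'.2⟩
  obtain ⟨δ, hδ, hd⟩ := hdisj.exists_thickenings (hAc.inter_right ht)
    (hAc.inter_right ht').isClosed
  have hlim : Filter.Tendsto (fun n : ℕ => c ^ n * Metric.diam A) Filter.atTop (nhds 0) := by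
    simpa using (tendsto_pow_atTop_nhds_zero_of_lt_one hc0 hc1).mul_const (Metric.diam A)
  obtain ⟨n, hn⟩ := (hlim.eventually (gt_mem_nhds hδ)).exists
  have hAt : A ⊆ t := by
    refine hchain n t ⟨x, hxA, hxt⟩ ?_
    intro u hu hut v hv huv
    by_contra hvt
    have hvt' : v ∈ t' := (hcov hv).resolve_left hvt
    have hd2 := Set.disjoint_left.mp hd
    refine @hd2 v ?_ ?_
    · rw [Metric.mem_thickening_iff]
      exact ⟨u, ⟨hu, hut⟩, by rw [dist_comm]; exact huv.trans_lt hn⟩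
    · exact Metric.self_subset_thickening hδ _ ⟨hv, hvt'⟩
  exact hemp ⟨y, hyA, hAt hyA, hyt⟩
end

section
/- Let (X,d) be a nonempty complete metric space with base point x₀, let α₁, α₂ : X → X be contractions with ratios c₁, c₂ ∈ (0,1), and let π : {1,2}^ℕ → X be the map sending u = (u₀, u₁, …) to the limit of ((α_{u₀} ∘ ⋯ ∘ α_{u_i})(x₀))_{i ≥ 0}. Then π is continuous when {1,2}^ℕ carries the product topology, its image A = π({1,2}^ℕ) is a nonempty compact subset of X, and A satisfies the self-similarity relation A = α₁(A) ∪ α₂(A). -/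
/-- The coding map `π : {1,2}^ℕ → X` of a system of two contractions (characterized
by the property that `π u` is the limit of `(α_{u 0} ∘ ⋯ ∘ α_{u i}) x₀`) is continuous
for the product topology, its image is a nonempty compact set, and this image — the
attractor — satisfies the self-similarity relation `A = α₁(A) ∪ α₂(A)`. -/
theorem stmt_4 {X : Type*} [MetricSpace X] [Nonempty X] [CompleteSpace X]
    (α₁ α₂ : X → X) (c₁ c₂ : ℝ)
    (hc₁ : c₁ ∈ Set.Ioo (0 : ℝ) 1) (hc₂ : c₂ ∈ Set.Ioo (0 : ℝ) 1)
    (hcontr₁ : ∀ x y : X, dist (α₁ x) (α₁ y) ≤ c₁ * dist x y)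
    (hcontr₂ : ∀ x y : X, dist (α₂ x) (α₂ y) ≤ c₂ * dist x y)
    (x₀ : X) (π : (ℕ → Bool) → X)
    (hπ : ∀ u : ℕ → Bool,
      Filter.Tendsto (fun i : ℕ =>
          ((List.range (i + 1)).map fun j => if u j then α₁ else α₂).foldr (· ∘ ·) id x₀)
        Filter.atTop (nhds (π u))) :
    Continuous π ∧ (Set.range π).Nonempty ∧ IsCompact (Set.range π) ∧
      Set.range π = α₁ '' Set.range π ∪ α₂ '' Set.range π := by
  obtain ⟨h10, h11⟩ := hc₁
  obtain ⟨h20, h21⟩ := hc₂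
  -- common ratio and letter maps
  set c := max c₁ c₂ with hc
  have hc0 : 0 < c := lt_max_of_lt_left h10
  have hc1 : c < 1 := max_lt h11 h21
  set f : Bool → X → X := fun b => if b then α₁ else α₂ with hf
  have hfc : ∀ b x y, dist (f b x) (f b y) ≤ c * dist x y := by
    intro b x y
    cases b
    · exact (hcontr₂ x y).trans (mul_le_mul_of_nonneg_right (le_max_right _ _) dist_nonneg)
    · exact (hcontr₁ x y).trans (mul_le_mul_of_nonneg_right (le_max_left _ _) dist_nonneg)
  have hfcont : ∀ b, Continuous (f b) := fun b =>
    (LipschitzWith.of_dist_le_mul (K := ⟨c, hc0.le⟩) (hfc b)).continuous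
  set p : ℕ → (ℕ → Bool) → X := fun n u =>
    ((List.range n).map fun j => if u j then α₁ else α₂).foldr (· ∘ ·) id x₀ with hp
  have hp0 : ∀ u, p 0 u = x₀ := fun u => rfl
  have hps : ∀ n u, p (n + 1) u = f (u 0) (p n (fun j => u (j + 1))) := by
    intro n u
    simp only [hp, hf, List.range_succ_eq_map, List.map_cons, List.foldr_cons, List.map_map,
      Function.comp_apply]
    rfl
  have hπ' : ∀ u, Filter.Tendsto (fun n => p n u) Filter.atTop (nhds (π u)) := fun u =>
    (Filter.tendsto_add_atTop_iff_nat 1).1 (hπ u)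
  have hrec : ∀ u, π u = f (u 0) (π (fun j => u (j + 1))) := by
    intro u
    have h1 := ((hfcont (u 0)).tendsto _).comp (hπ' (fun j => u (j + 1)))
    refine tendsto_nhds_unique (hπ u) (h1.congr ?_)
    intro n
    exact (hps n u).symm
  obtain ⟨D, hD⟩ : ∃ D, ∀ b, dist x₀ (f b x₀) ≤ D :=
    ⟨max (dist x₀ (f true x₀)) (dist x₀ (f false x₀)), fun b => by cases b <;> simp⟩
  have hD0 : 0 ≤ D := dist_nonneg.trans (hD true)
  obtain ⟨M, hM0, hM⟩ : ∃ M, 0 ≤ M ∧ D + c * M = M :=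
    ⟨D / (1 - c), div_nonneg hD0 (by linarith), by
      have : (1 - c) ≠ 0 := by linarith
      field_simp
      ring⟩
  have hpM : ∀ n u, dist x₀ (p n u) ≤ M := by
    intro n
    induction n with
    | zero => intro u; simpa [hp0] using hM0
    | succ n ih =>
      intro u
      rw [hps]
      have h1 := dist_triangle x₀ (f (u 0) x₀) (f (u 0) (p n (fun j => u (j + 1))))
      have h2 := hfc (u 0) x₀ (p n (fun j => u (j + 1)))
      have h3 := mul_le_mul_of_nonneg_left (ih (fun j => u (j + 1))) hc0.le
      linarith [hD (u 0)]
  have hπM : ∀ u, dist x₀ (π u) ≤ M := fun u =>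
    le_of_tendsto (tendsto_const_nhds.dist (hπ' u)) (Filter.Eventually.of_forall fun n => hpM n u)
  have hclose : ∀ n u v, (∀ j < n, u j = v j) → dist (π u) (π v) ≤ c ^ n * (2 * M) := by
    intro n
    induction n with
    | zero =>
      intro u v _
      have := dist_triangle_left (π u) (π v) x₀
      linarith [hπM u, hπM v]
    | succ n ih =>
      intro u v h
      rw [hrec u, hrec v, h 0 (by omega)]
      have h2 := ih (fun j => u (j + 1)) (fun j => v (j + 1)) (fun j hj => h (j + 1) (by omega))
      refine (hfc _ _ _).trans ((mul_le_mul_of_nonneg_left h2 hc0.le).trans (le_of_eq ?_))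
      ring
  have hcont : Continuous π := by
    rw [continuous_iff_continuousAt]
    intro u
    rw [ContinuousAt, Metric.tendsto_nhds]
    intro ε hε
    have hlim : Filter.Tendsto (fun n : ℕ => c ^ n * (2 * M)) Filter.atTop (nhds 0) := by
      simpa using (tendsto_pow_atTop_nhds_zero_of_lt_one hc0.le hc1).mul_const (2 * M)
    obtain ⟨n, hn⟩ := (hlim.eventually (gt_mem_nhds hε)).exists
    have hev : ∀ᶠ v in nhds u, ∀ j ∈ Set.Iio n, v j = u j := by
      rw [Filter.eventually_all_finite (Set.finite_Iio n)]
      intro j _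
      have := (continuous_apply (A := fun _ : ℕ => Bool) j).tendsto u
      rw [nhds_discrete Bool] at this
      exact Filter.tendsto_pure.1 this
    filter_upwards [hev] with v hv
    exact (hclose n v u hv).trans_lt hn
  refine ⟨hcont, Set.range_nonempty _, isCompact_range hcont, ?_⟩
  have hcons : ∀ b v, f b (π v) ∈ Set.range π := by
    intro b v
    refine ⟨fun n => Nat.casesOn n b v, ?_⟩
    exact hrec _
  apply Set.Subset.antisymm
  · rintro _ ⟨u, rfl⟩
    rw [hrec u]
    cases u 0
    · exact Or.inr ⟨_, ⟨_, rfl⟩, rfl⟩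
    · exact Or.inl ⟨_, ⟨_, rfl⟩, rfl⟩
  · rintro _ (⟨_, ⟨v, rfl⟩, rfl⟩ | ⟨_, ⟨v, rfl⟩, rfl⟩)
    · exact hcons true v
    · exact hcons false v
end

section
/- Let (X,d) be a metric space, let α₁, α₂ : X → X be contractions with ratios c₁, c₂ ∈ (0,1) satisfying c₁ + c₂ ≤ 1, and let A ⊆ X be a nonempty compact set with A = α₁(A) ∪ α₂(A). Then the one-dimensional Hausdorff measure of A satisfies H¹(A) ≤ diam(A). -/
open MeasureTheory

theorem cover_aux {X : Type*} [MetricSpace X] (α₁ α₂ : X → X) (K₁ K₂ : NNReal)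
    (h₁ : LipschitzWith K₁ α₁) (h₂ : LipschitzWith K₂ α₂) (hsum : K₁ + K₂ ≤ 1)
    (A : Set X) (hself : A = α₁ '' A ∪ α₂ '' A) (n : ℕ) :
    ∃ (ι : Type) (_ : Fintype ι) (t : ι → Set X),
      (∀ i, Metric.ediam (t i) ≤ ((max K₁ K₂ : NNReal) : ENNReal) ^ n * Metric.ediam A) ∧
      A ⊆ ⋃ i, t i ∧ ∑ i, Metric.ediam (t i) ≤ Metric.ediam A := by
  induction n with
  | zero => exact ⟨Unit, inferInstance, fun _ => A, by simp,
      fun x hx => Set.mem_iUnion.2 ⟨(), hx⟩, by simp⟩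
  | succ n ih =>
    obtain ⟨ι, _, t, hd, hc, hs⟩ := ih
    refine ⟨ι ⊕ ι, inferInstance, Sum.elim (fun i => α₁ '' t i) (fun i => α₂ '' t i), ?_, ?_, ?_⟩
    · rintro (i | i)
      · refine (h₁.ediam_image_le (t i)).trans ?_
        rw [pow_succ', mul_assoc]
        exact mul_le_mul' (ENNReal.coe_le_coe.2 (le_max_left _ _)) (hd i)
      · refine (h₂.ediam_image_le (t i)).trans ?_
        rw [pow_succ', mul_assoc]
        exact mul_le_mul' (ENNReal.coe_le_coe.2 (le_max_right _ _)) (hd i)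
    · intro x hx
      rw [hself] at hx
      rcases hx with ⟨y, hy, rfl⟩ | ⟨y, hy, rfl⟩
      · obtain ⟨i, hi⟩ := Set.mem_iUnion.1 (hc hy)
        exact Set.mem_iUnion.2 ⟨Sum.inl i, ⟨y, hi, rfl⟩⟩
      · obtain ⟨i, hi⟩ := Set.mem_iUnion.1 (hc hy)
        exact Set.mem_iUnion.2 ⟨Sum.inr i, ⟨y, hi, rfl⟩⟩
    · rw [Fintype.sum_sum_type]
      simp only [Sum.elim_inl, Sum.elim_inr]
      calc ∑ i, Metric.ediam (α₁ '' t i) + ∑ i, Metric.ediam (α₂ '' t i)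
          ≤ ∑ i, (K₁ : ENNReal) * Metric.ediam (t i) + ∑ i, (K₂ : ENNReal) * Metric.ediam (t i) :=
            add_le_add (Finset.sum_le_sum fun i _ => h₁.ediam_image_le (t i))
              (Finset.sum_le_sum fun i _ => h₂.ediam_image_le (t i))
        _ = ((K₁ + K₂ : NNReal) : ENNReal) * ∑ i, Metric.ediam (t i) := by
            rw [← Finset.mul_sum, ← Finset.mul_sum, ← add_mul, ENNReal.coe_add]
        _ ≤ 1 * Metric.ediam A := mul_le_mul' (by exact_mod_cast hsum) hs
        _ = _ := one_mul _

/-- If `A = α₁(A) ∪ α₂(A)` is a nonempty compact attractor of two contractions with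
ratios summing to at most 1, then the one-dimensional Hausdorff measure of `A` is at
most its diameter. -/
theorem stmt_6 {X : Type*} [MetricSpace X] [MeasurableSpace X] [BorelSpace X]
    (α₁ α₂ : X → X) (c₁ c₂ : ℝ)
    (hc₁ : c₁ ∈ Set.Ioo (0 : ℝ) 1) (hc₂ : c₂ ∈ Set.Ioo (0 : ℝ) 1)
    (hcontr₁ : ∀ x y : X, dist (α₁ x) (α₁ y) ≤ c₁ * dist x y)
    (hcontr₂ : ∀ x y : X, dist (α₂ x) (α₂ y) ≤ c₂ * dist x y)
    (hsum : c₁ + c₂ ≤ 1)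
    (A : Set X) (hA : A.Nonempty) (hAc : IsCompact A)
    (hself : A = α₁ '' A ∪ α₂ '' A) :
    μH[1] A ≤ EMetric.diam A := by
  lift c₁ to NNReal using hc₁.1.le
  lift c₂ to NNReal using hc₂.1.le
  have h₁ : LipschitzWith c₁ α₁ := LipschitzWith.of_dist_le_mul hcontr₁
  have h₂ : LipschitzWith c₂ α₂ := LipschitzWith.of_dist_le_mul hcontr₂
  have hK : max c₁ c₂ < 1 := max_lt (by exact_mod_cast hc₁.2) (by exact_mod_cast hc₂.2)
  choose ι hι t hd hc hs using
    cover_aux α₁ α₂ c₁ c₂ h₁ h₂ (by exact_mod_cast hsum) A hself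
  have hfin : Metric.ediam A ≠ ⊤ := hAc.isBounded.ediam_ne_top
  have hr : Filter.Tendsto
      (fun n : ℕ => ((max c₁ c₂ : NNReal) : ENNReal) ^ n * Metric.ediam A)
      Filter.atTop (nhds 0) := by
    have := ENNReal.Tendsto.mul_const (b := Metric.ediam A)
      (ENNReal.tendsto_pow_atTop_nhds_zero_of_lt_one
        (r := ((max c₁ c₂ : NNReal) : ENNReal)) (by exact_mod_cast hK)) (Or.inr hfin)
    simpa only [zero_mul] using this
  refine (Measure.hausdorffMeasure_le_liminf_sum 1 A _ hr t
    (Filter.Eventually.of_forall hd) (Filter.Eventually.of_forall hc)).trans ?_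
  refine Filter.liminf_le_of_le (by isBoundedDefault) fun b hb => ?_
  obtain ⟨n, hn⟩ := hb.exists
  refine hn.trans ?_
  simp only [ENNReal.rpow_one]
  exact hs n
end

section
/- Let (X,d) be a nonempty complete metric space, let α₁, α₂ : X → X be contractions with ratios c₁, c₂ ∈ (0,1) satisfying c₁ + c₂ ≤ 1 and having distinct fixed points, and let A ⊆ X be a nonempty compact set with A = α₁(A) ∪ α₂(A). If A is connected, then c₁ + c₂ = 1 and H¹(A) = diam(A) > 0. -/
open MeasureTheory

open scoped NNReal ENNReal in
/-- cylinder sets of the iterated function system -/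
def cylSet {X : Type*} (α : Fin 2 → X → X) (A : Set X) : (n : ℕ) → (Fin n → Fin 2) → Set X
  | 0, _ => A
  | n + 1, w => α (w 0) '' cylSet α A n (Fin.tail w)

open scoped NNReal ENNReal in
lemma cylSet_cover {X : Type*} (α : Fin 2 → X → X) (A : Set X)
    (h : A ⊆ ⋃ i, α i '' A) (n : ℕ) : A ⊆ ⋃ w, cylSet α A n w := by
  induction n with
  | zero => exact fun x hx => Set.mem_iUnion.2 ⟨Fin.elim0, hx⟩
  | succ n ih =>
    intro x hx
    obtain ⟨i, y, hy, rfl⟩ := Set.mem_iUnion.1 (h hx)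
    obtain ⟨w, hw⟩ := Set.mem_iUnion.1 (ih hy)
    refine Set.mem_iUnion.2 ⟨Fin.cons i w, ?_⟩
    simp only [cylSet, Fin.cons_zero, Fin.tail_cons]
    exact ⟨y, hw, rfl⟩

open scoped NNReal ENNReal in
lemma cylSet_diam {X : Type*} [MetricSpace X] (α : Fin 2 → X → X) (A : Set X)
    (c : Fin 2 → ℝ≥0) (h : ∀ i, LipschitzWith (c i) (α i)) (n : ℕ) (w : Fin n → Fin 2) :
    Metric.ediam (cylSet α A n w) ≤ (∏ i, (c (w i) : ℝ≥0∞)) * Metric.ediam A := by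
  induction n with
  | zero => simp [cylSet]
  | succ n ih =>
    rw [Fin.prod_univ_succ, mul_assoc]
    refine ((h (w 0)).ediam_image_le _).trans ?_
    gcongr
    exact ih (Fin.tail w)

open scoped NNReal ENNReal in
lemma hausdorff_le_aux {X : Type*} [MetricSpace X] [MeasurableSpace X] [BorelSpace X]
    (α : Fin 2 → X → X) (A : Set X) (hD : Metric.ediam A ≠ ∞)
    (c : Fin 2 → ℝ≥0) (h : ∀ i, LipschitzWith (c i) (α i)) (h1 : ∀ i, c i < 1)
    (hA : A ⊆ ⋃ i, α i '' A) :
    μH[1] A ≤ Filter.liminf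
      (fun n : ℕ => ((c 0 : ℝ≥0∞) + c 1) ^ n * Metric.ediam A) Filter.atTop := by
  have key := Measure.hausdorffMeasure_le_liminf_sum (l := Filter.atTop) (ι := fun n : ℕ => (Fin n → Fin 2))
    1 A (fun n => ((max (c 0) (c 1) : ℝ≥0) : ℝ≥0∞) ^ n * Metric.ediam A) ?_ (cylSet α A) ?_ ?_
  · refine key.trans (Filter.liminf_le_liminf (Filter.Eventually.of_forall fun n => ?_))
    simp only [ENNReal.rpow_one]
    refine (Finset.sum_le_sum fun w _ => cylSet_diam α A c h n w).trans ?_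
    rw [← Finset.sum_mul]
    gcongr
    have := Finset.sum_pow' (Finset.univ : Finset (Fin 2)) (fun i => (c i : ℝ≥0∞)) n
    rw [← Fin.sum_univ_two (fun i => (c i : ℝ≥0∞)), this]
    simp
  · have : Filter.Tendsto (fun n : ℕ => ((max (c 0) (c 1) : ℝ≥0) : ℝ≥0∞) ^ n) Filter.atTop (nhds 0) :=
      ENNReal.tendsto_pow_atTop_nhds_zero_of_lt_one (by
        exact_mod_cast max_lt (h1 0) (h1 1))
    simpa using ENNReal.Tendsto.mul_const this (Or.inr hD)
  · refine Filter.Eventually.of_forall fun n w => (cylSet_diam α A c h n w).trans ?_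
    gcongr
    refine (Finset.prod_le_pow_card _ _ ((max (c 0) (c 1) : ℝ≥0) : ℝ≥0∞) fun i _ => ?_).trans (by simp)
    norm_cast
    generalize w i = j
    fin_cases j <;> simp
  · exact Filter.Eventually.of_forall fun n => cylSet_cover α A hA n

lemma diam_le_hausdorff {X : Type*} [MetricSpace X] [MeasurableSpace X] [BorelSpace X]
    (A : Set X) (hA : IsConnected A) : Metric.ediam A ≤ μH[1] A := by
  refine Metric.ediam_le fun x hx y hy => ?_
  have hl : LipschitzWith 1 (fun z => dist x z) := LipschitzWith.dist_right x
  have h2 := hl.lipschitzOnWith (s := A) |>.hausdorffMeasure_image_le (d := 1) zero_le_one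
  have h3 : Set.Icc 0 (dist x y) ⊆ (fun z => dist x z) '' A :=
    (hA.isPreconnected.image _ hl.continuous.continuousOn).Icc_subset
      ⟨x, hx, dist_self x⟩ ⟨y, hy, rfl⟩
  have h4 := measure_mono (μ := μH[1]) h3
  rw [hausdorffMeasure_real, Real.volume_Icc, sub_zero, ← edist_dist] at h4
  simpa [hausdorffMeasure_real] using h4.trans (by simpa [hausdorffMeasure_real] using h2)

lemma exists_fix_s9 {X : Type*} [MetricSpace X] (α : X → X) (c : ℝ)
    (hc : c ∈ Set.Ioo (0 : ℝ) 1) (h : ∀ x y : X, dist (α x) (α y) ≤ c * dist x y)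
    (A : Set X) (hA : A.Nonempty) (hAc : IsCompact A) (hm : Set.MapsTo α A A) :
    ∃ p ∈ A, α p = p := by
  have hl : LipschitzWith ⟨c, hc.1.le⟩ α := LipschitzWith.of_dist_le_mul h
  obtain ⟨x, hx⟩ := hA
  have hcon : ContractingWith ⟨c, hc.1.le⟩ (hm.restrict α A A) :=
    ⟨by exact_mod_cast hc.2, fun a b => hl a b⟩
  obtain ⟨y, hy, hf, -⟩ := hcon.exists_fixedPoint' hAc.isComplete hm hx (edist_ne_top _ _)
  exact ⟨y, hy, hf⟩

/-- If the attractor `A` of two contractions with distinct fixed points and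
`c₁ + c₂ ≤ 1` is connected, then necessarily `c₁ + c₂ = 1` and
`H¹(A) = diam(A) > 0`. -/
theorem stmt_9 {X : Type*} [MetricSpace X] [Nonempty X] [CompleteSpace X]
    [MeasurableSpace X] [BorelSpace X]
    (α₁ α₂ : X → X) (c₁ c₂ : ℝ)
    (hc₁ : c₁ ∈ Set.Ioo (0 : ℝ) 1) (hc₂ : c₂ ∈ Set.Ioo (0 : ℝ) 1)
    (hcontr₁ : ∀ x y : X, dist (α₁ x) (α₁ y) ≤ c₁ * dist x y)
    (hcontr₂ : ∀ x y : X, dist (α₂ x) (α₂ y) ≤ c₂ * dist x y)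
    (hsum : c₁ + c₂ ≤ 1)
    (hfix : ∀ p q : X, α₁ p = p → α₂ q = q → p ≠ q)
    (A : Set X) (hA : A.Nonempty) (hAc : IsCompact A)
    (hself : A = α₁ '' A ∪ α₂ '' A)
    (hconn : IsConnected A) :
    c₁ + c₂ = 1 ∧ μH[1] A = EMetric.diam A ∧ 0 < EMetric.diam A := by
  lift c₁ to NNReal using hc₁.1.le
  lift c₂ to NNReal using hc₂.1.le
  change (c₁ : ℝ) + c₂ = 1 ∧ μH[1] A = Metric.ediam A ∧ 0 < Metric.ediam A
  have m1 : Set.MapsTo α₁ A A := fun x hx => by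
    rw [hself]; exact Or.inl ⟨x, hx, rfl⟩
  have m2 : Set.MapsTo α₂ A A := fun x hx => by
    rw [hself]; exact Or.inr ⟨x, hx, rfl⟩
  obtain ⟨p, hp, hpf⟩ := exists_fix_s9 α₁ c₁ hc₁ hcontr₁ A hA hAc m1
  obtain ⟨q, hq, hqf⟩ := exists_fix_s9 α₂ c₂ hc₂ hcontr₂ A hA hAc m2
  have hpos : 0 < Metric.ediam A :=
    (edist_pos.2 (hfix p q hpf hqf)).trans_le (Metric.edist_le_ediam_of_mem hp hq)
  have hD : Metric.ediam A ≠ ⊤ := hAc.isBounded.ediam_ne_top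
  have hlow := diam_le_hausdorff A hconn
  have hup := hausdorff_le_aux ![α₁, α₂] A hD ![c₁, c₂]
    (by
      intro i
      fin_cases i
      · exact LipschitzWith.of_dist_le_mul hcontr₁
      · exact LipschitzWith.of_dist_le_mul hcontr₂)
    (by
      intro i
      fin_cases i
      · exact_mod_cast hc₁.2
      · exact_mod_cast hc₂.2)
    (by
      intro x hx
      rw [hself] at hx
      rcases hx with hx | hx
      · exact Set.mem_iUnion.2 ⟨0, hx⟩
      · exact Set.mem_iUnion.2 ⟨1, hx⟩)
  replace hup : μH[1] A ≤ Filter.liminf (fun n : ℕ => ((c₁ : ENNReal) +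
        (c₂ : ENNReal)) ^ n * Metric.ediam A) Filter.atTop := hup
  have hs : (c₁ : ℝ) + c₂ = 1 := by
    by_contra hne
    have hlt := lt_of_le_of_ne hsum hne
    have ht : Filter.Tendsto (fun n : ℕ => ((c₁ : ENNReal) +
        (c₂ : ENNReal)) ^ n * Metric.ediam A) Filter.atTop (nhds 0) := by
      have := ENNReal.tendsto_pow_atTop_nhds_zero_of_lt_one (r := (c₁ : ENNReal) +
        (c₂ : ENNReal)) (by
          rw [← ENNReal.coe_add]
          exact ENNReal.coe_lt_one_iff.2 hlt)
      simpa using ENNReal.Tendsto.mul_const this (Or.inr hD)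
    rw [ht.liminf_eq] at hup
    exact absurd (hlow.trans hup) (not_le.2 hpos)
  refine ⟨hs, le_antisymm ?_ hlow, hpos⟩
  have h1 : (c₁ : ENNReal) + (c₂ : ENNReal) = 1 := by
    rw [← ENNReal.coe_add, ENNReal.coe_eq_one]
    exact NNReal.eq hs
  rw [h1] at hup
  simpa using hup
end

section
/- Let (X,d) be a nonempty complete metric space, let α₁, α₂ : X → X be contractions with ratios c₁, c₂ ∈ (0,1) satisfying c₁ + c₂ ≤ 1 and having distinct fixed points, and let A ⊆ X be a nonempty compact connected set with A = α₁(A) ∪ α₂(A). Then H¹(α₁(A) ∩ α₂(A)) = 0. -/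
open MeasureTheory

/-- Iterated covers of the attractor, indexed by words of length `n`. -/
theorem exists_cover_aux {X : Type*} [MetricSpace X] (α : Bool → X → X) (c : Bool → NNReal)
    (hα : ∀ b, LipschitzWith (c b) (α b)) (A : Set X)
    (hself : A ⊆ ⋃ b, α b '' A) (n : ℕ) :
    ∃ T : (Fin n → Bool) → Set X, A ⊆ ⋃ w, T w ∧
      ∀ w, Metric.ediam (T w) ≤ ((∏ i, c (w i) : NNReal) : ENNReal) * Metric.ediam A := by
  induction n with
  | zero => exact ⟨fun _ => A, fun x hx => Set.mem_iUnion.2 ⟨Fin.elim0, hx⟩, fun w => by simp⟩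
  | succ n ih =>
    obtain ⟨T, hT, hd⟩ := ih
    refine ⟨fun w => α (w 0) '' T (Fin.tail w), ?_, ?_⟩
    · intro x hx
      obtain ⟨b, y, hy, rfl⟩ := Set.mem_iUnion.1 (hself hx)
      obtain ⟨w, hw⟩ := Set.mem_iUnion.1 (hT hy)
      refine Set.mem_iUnion.2 ⟨Fin.cons b w, ?_⟩
      simp only [Fin.cons_zero, Fin.tail_cons]
      exact ⟨y, hw, rfl⟩
    · intro w
      refine ((hα (w 0)).ediam_image_le _).trans ?_
      rw [Fin.prod_univ_succ, ENNReal.coe_mul, mul_assoc]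
      exact mul_le_mul_right (hd (Fin.tail w)) _

theorem hausdorff_lt_top_aux {X : Type*} [MetricSpace X] [MeasurableSpace X] [BorelSpace X]
    (α : Bool → X → X) (c : Bool → NNReal) (r : NNReal) (hr : r < 1) (hcr : ∀ b, c b ≤ r)
    (hα : ∀ b, LipschitzWith (c b) (α b)) (hsum : ∑ b, c b ≤ 1) (A : Set X)
    (hA : Metric.ediam A ≠ ⊤)
    (hself : A ⊆ ⋃ b, α b '' A) : μH[1] A < ⊤ := by
  choose T hT hd using exists_cover_aux α c hα A hself
  have h := Measure.hausdorffMeasure_le_liminf_sum (l := Filter.atTop) (1 : ℝ) A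
    (fun n : ℕ => (r : ENNReal) ^ n * Metric.ediam A) ?_ T ?_ (Filter.Eventually.of_forall hT)
  · refine lt_of_le_of_lt (h.trans ?_) hA.lt_top
    refine Filter.liminf_le_of_le (by isBoundedDefault) ?_
    intro b hb
    obtain ⟨n, hn⟩ := hb.exists
    refine hn.trans ?_
    simp only [ENNReal.rpow_one]
    refine (Finset.sum_le_sum fun w _ => hd n w).trans ?_
    rw [← Finset.sum_mul, ← ENNReal.ofNNReal_finsetSum, ← Fintype.sum_pow]
    refine mul_le_of_le_one_left zero_le ?_
    exact_mod_cast pow_le_one₀ zero_le hsum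
  · have := ENNReal.Tendsto.mul_const (b := Metric.ediam A)
      (ENNReal.tendsto_pow_atTop_nhds_zero_of_lt_one (r := (r : ENNReal)) (by exact_mod_cast hr))
      (Or.inr hA)
    simpa using this
  · refine Filter.Eventually.of_forall fun n w => (hd n w).trans ?_
    refine mul_le_mul_left ?_ _
    have : ∏ i, c (w i) ≤ ∏ _i : Fin n, r := Finset.prod_le_prod' fun i _ => hcr _
    simp only [Finset.prod_const, Finset.card_univ, Fintype.card_fin] at this
    exact_mod_cast this

/-- If the attractor `A` of two contractions with distinct fixed points and
`c₁ + c₂ ≤ 1` is connected, then `α₁(A) ∩ α₂(A)` has vanishing one-dimensional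
Hausdorff measure. -/
theorem stmt_10 {X : Type*} [MetricSpace X] [Nonempty X] [CompleteSpace X]
    [MeasurableSpace X] [BorelSpace X]
    (α₁ α₂ : X → X) (c₁ c₂ : ℝ)
    (hc₁ : c₁ ∈ Set.Ioo (0 : ℝ) 1) (hc₂ : c₂ ∈ Set.Ioo (0 : ℝ) 1)
    (hcontr₁ : ∀ x y : X, dist (α₁ x) (α₁ y) ≤ c₁ * dist x y)
    (hcontr₂ : ∀ x y : X, dist (α₂ x) (α₂ y) ≤ c₂ * dist x y)
    (hsum : c₁ + c₂ ≤ 1)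
    (hfix : ∀ p q : X, α₁ p = p → α₂ q = q → p ≠ q)
    (A : Set X) (hA : A.Nonempty) (hAc : IsCompact A) (hconn : IsConnected A)
    (hself : A = α₁ '' A ∪ α₂ '' A) :
    μH[1] ((α₁ '' A) ∩ (α₂ '' A)) = 0 := by
  lift c₁ to NNReal using hc₁.1.le
  lift c₂ to NNReal using hc₂.1.le
  have h1 : LipschitzWith c₁ α₁ := LipschitzWith.of_dist_le_mul hcontr₁
  have h2 : LipschitzWith c₂ α₂ := LipschitzWith.of_dist_le_mul hcontr₂
  have hs : c₁ + c₂ ≤ 1 := by exact_mod_cast hsum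
  have hfin : μH[1] A < ⊤ := by
    refine hausdorff_lt_top_aux (fun b => if b then α₁ else α₂) (fun b => if b then c₁ else c₂)
      (max c₁ c₂) (max_lt (by exact_mod_cast hc₁.2) (by exact_mod_cast hc₂.2)) ?_ ?_ ?_ A
      hAc.isBounded.ediam_ne_top ?_
    · rintro (_ | _) <;> simp
    · rintro (_ | _) <;> simpa
    · simpa using hs
    · intro x hx
      rw [hself] at hx
      rcases hx with hx | hx
      · exact Set.mem_iUnion.2 ⟨true, by simpa using hx⟩
      · exact Set.mem_iUnion.2 ⟨false, by simpa using hx⟩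
  have e1 := h1.hausdorffMeasure_image_le (d := 1) zero_le_one A
  have e2 := h2.hausdorffMeasure_image_le (d := 1) zero_le_one A
  rw [ENNReal.rpow_one] at e1 e2
  have hm : MeasurableSet (α₂ '' A) := (hAc.image h2.continuous).measurableSet
  have key := measure_union_add_inter (μ := (μH[1] : Measure X)) (α₁ '' A) hm
  rw [← hself] at key
  have hle : μH[1] A + μH[1] (α₁ '' A ∩ α₂ '' A) ≤ μH[1] A + 0 := by
    rw [key, add_zero]
    refine (add_le_add e1 e2).trans ?_
    rw [← add_mul]
    exact mul_le_of_le_one_left zero_le (by exact_mod_cast hs)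
  exact nonpos_iff_eq_zero.1 ((ENNReal.add_le_add_iff_left hfin.ne).1 hle)
end

section
/- Let (X,d) be a metric space, let α₁, α₂ : X → X be injective contractions with ratios c₁, c₂ ∈ (0,1), and let A ⊆ X be a nonempty compact connected set with A = α₁(A) ∪ α₂(A), diam(A) > 0, and H¹(α₁(A) ∩ α₂(A)) = 0. Then α₁ and α₂ generate a free semigroup of rank 2 under composition. -/
open MeasureTheory

/-- A preconnected set with two distinct points has positive `H¹`. -/
lemma hausdorff_ne_zero {X : Type*} [MetricSpace X] [MeasurableSpace X] [BorelSpace X]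
    (B : Set X) (hB : IsPreconnected B) (x y : X) (hx : x ∈ B) (hy : y ∈ B) (hxy : x ≠ y) :
    μH[1] B ≠ 0 := by
  intro h0
  have hL : LipschitzWith 1 (fun z => dist x z) := LipschitzWith.dist_right x
  have h1 := hL.lipschitzOnWith (s := B) |>.hausdorffMeasure_image_le (d := 1) zero_le_one
  rw [h0, mul_zero, hausdorffMeasure_real] at h1
  have hsub : Set.Icc 0 (dist x y) ⊆ (fun z => dist x z) '' B := by
    have := (hB.image _ hL.continuous.continuousOn).Icc_subset
      (Set.mem_image_of_mem _ hx) (Set.mem_image_of_mem _ hy)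
    simpa using this
  have h2 := (measure_mono (μ := volume) hsub).trans h1
  rw [Real.volume_Icc] at h2
  have := dist_pos.2 hxy
  simp at h2
  exact hxy h2

/-- Composition along a word. -/
def wordEval {X : Type*} (f : Bool → X → X) (w : List Bool) : X → X :=
  (w.map f).foldr (· ∘ ·) id

lemma wordEval_cons {X : Type*} (f : Bool → X → X) (b : Bool) (w : List Bool) :
    wordEval f (b :: w) = f b ∘ wordEval f w := rfl

lemma wordEval_inj {X : Type*} (f : Bool → X → X) (hf : ∀ b, Function.Injective (f b))
    (w : List Bool) : Function.Injective (wordEval f w) := by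
  induction w with
  | nil => exact Function.injective_id
  | cons b t ih => exact (hf b).comp ih

lemma wordEval_lip {X : Type*} [MetricSpace X] (f : Bool → X → X)
    (hf : ∀ b, LipschitzWith 1 (f b)) (w : List Bool) : LipschitzWith 1 (wordEval f w) := by
  induction w with
  | nil => exact LipschitzWith.id
  | cons b t ih => simpa [wordEval_cons] using (hf b).comp ih

lemma wordEval_maps {X : Type*} (f : Bool → X → X) (A : Set X)
    (hf : ∀ b, Set.MapsTo (f b) A A) (w : List Bool) : Set.MapsTo (wordEval f w) A A := by
  induction w with
  | nil => exact Set.mapsTo_id A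
  | cons b t ih => exact (hf b).comp ih

lemma wordEval_cons_ne_id {X : Type*} [MetricSpace X] (f : Bool → X → X)
    (hf : ∀ b, LipschitzWith 1 (f b))
    (hs : ∀ b x y, x ≠ y → dist (f b x) (f b y) < dist x y)
    (x y : X) (hxy : x ≠ y) (b : Bool) (w : List Bool) : wordEval f (b :: w) ≠ id := by
  intro h
  have hx := congrFun h x
  have hy := congrFun h y
  simp only [wordEval_cons, Function.comp, id] at hx hy
  have hne : wordEval f w x ≠ wordEval f w y := by
    intro he
    rw [he, hy] at hx
    exact hxy hx.symm
  have h1 := hs b _ _ hne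
  rw [hx, hy] at h1
  have h2 := (wordEval_lip f hf w).dist_le_mul x y
  simp at h2
  linarith

lemma wordEval_injective {X : Type*} [MetricSpace X] [MeasurableSpace X] [BorelSpace X]
    (f : Bool → X → X) (hf : ∀ b, LipschitzWith 1 (f b))
    (hs : ∀ b x y, x ≠ y → dist (f b x) (f b y) < dist x y)
    (hinj : ∀ b, Function.Injective (f b))
    (A : Set X) (hmaps : ∀ b, Set.MapsTo (f b) A A) (hA : IsPreconnected A)
    (x y : X) (hx : x ∈ A) (hy : y ∈ A) (hxy : x ≠ y)
    (hmeas : ∀ b b', b ≠ b' → μH[1] ((f b '' A) ∩ (f b' '' A)) = 0)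
    (w₁ : List Bool) : ∀ w₂, wordEval f w₁ = wordEval f w₂ → w₁ = w₂ := by
  induction w₁ with
  | nil =>
    rintro (_ | ⟨b, t⟩) h
    · rfl
    · exact absurd h.symm (wordEval_cons_ne_id f hf hs x y hxy b t)
  | cons a s ih =>
    rintro (_ | ⟨b, t⟩) h
    · exact absurd h (wordEval_cons_ne_id f hf hs x y hxy a s)
    · by_cases hab : a = b
      · subst hab
        rw [ih t ((hinj a).comp_left h)]
      · exfalso
        refine hausdorff_ne_zero (wordEval f (a :: s) '' A)
          (hA.image _ (wordEval_lip f hf _).continuous.continuousOn) _ _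
          (Set.mem_image_of_mem _ hx) (Set.mem_image_of_mem _ hy)
          ((wordEval_inj f hinj _).ne hxy) (measure_mono_null ?_ (hmeas a b hab))
        rintro _ ⟨z, hz, rfl⟩
        refine ⟨⟨_, wordEval_maps f A hmaps s hz, rfl⟩, ?_⟩
        rw [h]
        exact ⟨_, wordEval_maps f A hmaps t hz, rfl⟩

/-- Measurable ping-pong: two injective contractions preserving a nonempty compact
connected set `A` of positive diameter, whose images inside `A` overlap in a set of
zero one-dimensional Hausdorff measure, generate a free semigroup of rank 2. -/
theorem stmt_12 {X : Type*} [MetricSpace X] [MeasurableSpace X] [BorelSpace X]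
    (α₁ α₂ : X → X) (c₁ c₂ : ℝ)
    (hc₁ : c₁ ∈ Set.Ioo (0 : ℝ) 1) (hc₂ : c₂ ∈ Set.Ioo (0 : ℝ) 1)
    (hcontr₁ : ∀ x y : X, dist (α₁ x) (α₁ y) ≤ c₁ * dist x y)
    (hcontr₂ : ∀ x y : X, dist (α₂ x) (α₂ y) ≤ c₂ * dist x y)
    (hinj₁ : Function.Injective α₁) (hinj₂ : Function.Injective α₂)
    (A : Set X) (hA : A.Nonempty) (hAc : IsCompact A) (hconn : IsConnected A)
    (hself : A = α₁ '' A ∪ α₂ '' A)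
    (hdiam : 0 < Metric.diam A)
    (hmeas : μH[1] ((α₁ '' A) ∩ (α₂ '' A)) = 0) :
    ∀ w₁ w₂ : List Bool, w₁ ≠ [] → w₂ ≠ [] →
      (w₁.map fun b => if b then α₁ else α₂).foldr (· ∘ ·) id =
        (w₂.map fun b => if b then α₁ else α₂).foldr (· ∘ ·) id →
      w₁ = w₂ := by
  have key : ∀ (g : X → X) (c : ℝ), c ∈ Set.Ioo (0 : ℝ) 1 →
      (∀ x y : X, dist (g x) (g y) ≤ c * dist x y) →
      LipschitzWith 1 g ∧ ∀ x y, x ≠ y → dist (g x) (g y) < dist x y := by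
    intro g c hc hg
    refine ⟨LipschitzWith.of_dist_le_mul fun x y => ?_, fun x y hxy => ?_⟩
    · have := hg x y
      have := dist_nonneg (x := x) (y := y)
      have := hc.2
      simp only [NNReal.coe_one]
      nlinarith
    · have := hg x y
      have := dist_pos.2 hxy
      have := hc.2
      nlinarith
  have k1 := key α₁ c₁ hc₁ hcontr₁
  have k2 := key α₂ c₂ hc₂ hcontr₂
  have hnt : A.Nontrivial := by
    by_contra h
    rw [Set.not_nontrivial_iff] at h
    rw [Metric.diam_subsingleton h] at hdiam
    exact lt_irrefl _ hdiam
  obtain ⟨x, hx, y, hy, hxy⟩ := hnt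
  have m1 : Set.MapsTo α₁ A A := fun z hz => by
    rw [hself]; exact Or.inl ⟨z, hz, rfl⟩
  have m2 : Set.MapsTo α₂ A A := fun z hz => by
    rw [hself]; exact Or.inr ⟨z, hz, rfl⟩
  intro w₁ w₂ _ _ h
  refine wordEval_injective (fun b => if b then α₁ else α₂) ?_ ?_ ?_ A ?_ hconn.isPreconnected
    x y hx hy hxy ?_ w₁ w₂ h
  · rintro (_ | _)
    · simpa using k2.1
    · simpa using k1.1
  · rintro (_ | _)
    · simpa using k2.2
    · simpa using k1.2
  · rintro (_ | _)
    · simpa using hinj₂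
    · simpa using hinj₁
  · rintro (_ | _)
    · simpa using m2
    · simpa using m1
  · rintro (_ | _) (_ | _) hb
    · exact absurd rfl hb
    · simpa [Set.inter_comm] using hmeas
    · simpa using hmeas
    · exact absurd rfl hb
end

section
/- Let X be a set, let f₁, f₂ : X → X be surjective maps, let d₁, d₂ ≥ 2 be integers, and let h₁, h₂ : X → ℝ be functions satisfying h₁(f₁(x)) = d₁·h₁(x) and h₂(f₂(x)) = d₂·h₂(x) for all x ∈ X. Suppose the difference h₁ − h₂ is a bounded function and h₁ ≠ h₂. Then f₁ and f₂ generate a free semigroup of rank 2 under composition: any two distinct nonempty finite words in f₁, f₂ define distinct maps X → X. -/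
namespace FreeSemi

variable {X : Type*}

/-- Normalized pullback. -/
noncomputable def T (f : Bool → X → X) (d : Bool → ℝ) (b : Bool) (φ : X → ℝ) : X → ℝ :=
  fun x => φ (f b x) / d b

/-- Composition, the head of the list being applied first. -/
def G (f : Bool → X → X) : List Bool → X → X
  | [] => id
  | b :: L => G f L ∘ f b

/-- Degree of a word. -/
def D (d : Bool → ℝ) : List Bool → ℝ
  | [] => 1
  | b :: L => D d L * d b

/-- Normalized pullback along a word. -/
noncomputable def TL (f : Bool → X → X) (d : Bool → ℝ) : List Bool → (X → ℝ) → (X → ℝ)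
  | [], φ => φ
  | b :: L, φ => T f d b (TL f d L φ)

/-- All pullbacks of the two heights. -/
inductive S (f : Bool → X → X) (d : Bool → ℝ) (h : Bool → X → ℝ) : (X → ℝ) → Prop
  | base (b : Bool) : S f d h (h b)
  | step (b : Bool) (φ : X → ℝ) : S f d h φ → S f d h (T f d b φ)

theorem TL_eq (f : Bool → X → X) (d : Bool → ℝ) (L : List Bool) (φ : X → ℝ) (x : X) :
    TL f d L φ x = φ (G f L x) / D d L := by
  induction L generalizing x with
  | nil => simp [TL, G, D]
  | cons b L ih => simp [TL, G, D, T, ih, div_div]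

theorem D_ge (d : Bool → ℝ) (hd : ∀ b, 2 ≤ d b) (L : List Bool) : 1 ≤ D d L := by
  induction L with
  | nil => simp [D]
  | cons b L ih => simp only [D]; nlinarith [hd b]

theorem S_TL {f : Bool → X → X} {d : Bool → ℝ} {h : Bool → X → ℝ} (L : List Bool)
    {φ : X → ℝ} (hφ : S f d h φ) : S f d h (TL f d L φ) := by
  induction L with
  | nil => exact hφ
  | cons b L ih => exact S.step b _ ih

theorem S_cases {f : Bool → X → X} {d : Bool → ℝ} {h : Bool → X → ℝ}
    (hd : ∀ b, 2 ≤ d b) (hh : ∀ b x, h b (f b x) = d b * h b x)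
    {φ : X → ℝ} (hφ : S f d h φ) : ∃ b ψ, S f d h ψ ∧ φ = T f d b ψ := by
  cases hφ with
  | base b =>
    refine ⟨b, h b, S.base b, ?_⟩
    funext x
    have := hd b
    rw [T, hh, mul_div_cancel_left₀]
    linarith
  | step b ψ hψ => exact ⟨b, ψ, hψ, rfl⟩

theorem div_bd {a r d : ℝ} (hd : 2 ≤ d) (ha : |a| ≤ r) : |a / d| ≤ r / 2 := by
  have h0 := abs_nonneg a
  rw [abs_div, abs_of_pos (by linarith : 0 < d), div_le_div_iff₀ (by linarith) (by norm_num)]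
  nlinarith

theorem T_dist (f : Bool → X → X) (d : Bool → ℝ) (hd : ∀ b, 2 ≤ d b) (b : Bool)
    {φ ψ : X → ℝ} {r : ℝ} (h : ∀ x, |φ x - ψ x| ≤ r) (x : X) :
    |T f d b φ x - T f d b ψ x| ≤ r / 2 := by
  simp only [T, ← sub_div]
  exact div_bd (hd b) (h _)

theorem S_bdd {f : Bool → X → X} {d : Bool → ℝ} {h : Bool → X → ℝ}
    (hd : ∀ b, 2 ≤ d b) (hh : ∀ b x, h b (f b x) = d b * h b x) {C : ℝ}
    (hC : ∀ b c x, |h b x - h c x| ≤ C) {φ : X → ℝ} (hφ : S f d h φ) :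
    ∀ c x, |φ x - h c x| ≤ 3 * C := by
  induction hφ with
  | base b =>
    intro c x
    have := hC b c x
    have := abs_nonneg (h b x - h c x)
    linarith
  | step b φ _ ih =>
    intro c x
    have h1 := div_bd (hd b) (ih b (f b x))
    have h2 : (φ (f b x) - h b (f b x)) / d b = T f d b φ x - h b x := by
      have := hd b
      rw [sub_div, hh, mul_div_cancel_left₀ _ (by linarith)]
      rfl
    rw [h2] at h1
    have h3 := hC b c x
    have h4 := abs_sub_le (T f d b φ x) (h b x) (h c x)
    have := abs_nonneg (h b x - h c x)
    linarith

theorem zero_of_le_pow {a κ B : ℝ} (h0 : 0 ≤ κ) (h1 : κ < 1) (h : ∀ n : ℕ, |a| ≤ κ ^ n * B) :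
    a = 0 := by
  have ht : Filter.Tendsto (fun n : ℕ => κ ^ n * B) Filter.atTop (nhds (0 * B)) :=
    (tendsto_pow_atTop_nhds_zero_of_lt_one h0 h1).mul_const B
  have := ge_of_tendsto' ht h
  rw [zero_mul] at this
  exact abs_nonpos_iff.mp this

theorem approx {f : Bool → X → X} {d : Bool → ℝ} {h : Bool → X → ℝ}
    (hd : ∀ b, 2 ≤ d b) (hh : ∀ b x, h b (f b x) = d b * h b x)
    (W : Bool → List Bool)
    (hW : ∀ b c φ, TL f d (b :: W b) φ = TL f d (c :: W c) φ) (P : List Bool) :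
    ∃ κ : ℝ, 0 ≤ κ ∧ κ < 1 ∧ ∀ Δ : ℝ, 0 ≤ Δ →
      (∀ φ ψ, S f d h φ → S f d h ψ → ∀ x, |φ x - ψ x| ≤ Δ) →
      ∀ ψ, S f d h ψ → ∃ φ, S f d h φ ∧ ∀ x, |TL f d P φ x - ψ x| ≤ κ * Δ := by
  induction P with
  | nil =>
    refine ⟨0, le_rfl, one_pos, fun Δ _ _ ψ hψ => ⟨ψ, hψ, fun x => ?_⟩⟩
    simp [TL]
  | cons b P ih =>
    obtain ⟨κ, h0, h1, H⟩ := ih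
    refine ⟨(κ + 1) / 2, by linarith, by linarith, fun Δ hΔ hS ψ hψ => ?_⟩
    obtain ⟨c, ψ', hψ', rfl⟩ := S_cases hd hh hψ
    obtain ⟨φ, hφ, hb⟩ := H Δ hΔ hS (TL f d (W b) (h true)) (S_TL _ (S.base true))
    refine ⟨φ, hφ, fun x => ?_⟩
    have e1 := T_dist f d hd b hb x
    have e2 := T_dist f d hd c (hS (TL f d (W c) (h true)) ψ' (S_TL _ (S.base true)) hψ') x
    have e3 : T f d b (TL f d (W b) (h true)) x = T f d c (TL f d (W c) (h true)) x :=
      congrFun (hW b c (h true)) x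
    have e4 := abs_sub_le (T f d b (TL f d P φ) x) (T f d b (TL f d (W b) (h true)) x)
      (T f d c ψ' x)
    rw [← e3] at e2
    simp only [TL]
    linarith

theorem heights_eq {f : Bool → X → X} {d : Bool → ℝ} {h : Bool → X → ℝ}
    (hd : ∀ b, 2 ≤ d b) (hh : ∀ b x, h b (f b x) = d b * h b x) {C : ℝ}
    (hC : ∀ b c x, |h b x - h c x| ≤ C)
    (W : Bool → List Bool)
    (hW : ∀ b c φ, TL f d (b :: W b) φ = TL f d (c :: W c) φ) (b c : Bool) : h b = h c := by
  funext x
  have hC0 : 0 ≤ C := (abs_nonneg _).trans (hC b c x)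
  -- a uniform contraction factor for all pairs
  obtain ⟨κ, h0, h1, H⟩ : ∃ κ : ℝ, 0 ≤ κ ∧ κ < 1 ∧ ∀ Δ : ℝ, 0 ≤ Δ →
      (∀ φ ψ, S f d h φ → S f d h ψ → ∀ x, |φ x - ψ x| ≤ Δ) →
      ∀ φ ψ, S f d h φ → S f d h ψ → ∀ x, |φ x - ψ x| ≤ κ * Δ := by
    obtain ⟨κ₁, a0, a1, A⟩ := approx hd hh W hW (W true)
    obtain ⟨κ₂, b0, b1, B⟩ := approx hd hh W hW (W false)
    refine ⟨(max κ₁ κ₂ + 1) / 2, by positivity, by linarith [max_lt a1 b1],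
      fun Δ hΔ hS φ ψ hφ hψ x => ?_⟩
    obtain ⟨b, φ', hφ', rfl⟩ := S_cases hd hh hφ
    obtain ⟨c, ψ', hψ', rfl⟩ := S_cases hd hh hψ
    obtain ⟨ω, hω, hb⟩ : ∃ ω, S f d h ω ∧ ∀ x, |TL f d (W b) ω x - φ' x| ≤ max κ₁ κ₂ * Δ := by
      cases b with
      | true =>
        obtain ⟨ω, hω, hb⟩ := A Δ hΔ hS φ' hφ'
        exact ⟨ω, hω, fun x => (hb x).trans
          (mul_le_mul_of_nonneg_right (le_max_left _ _) hΔ)⟩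
      | false =>
        obtain ⟨ω, hω, hb⟩ := B Δ hΔ hS φ' hφ'
        exact ⟨ω, hω, fun x => (hb x).trans
          (mul_le_mul_of_nonneg_right (le_max_right _ _) hΔ)⟩
    have e1 := T_dist f d hd b hb x
    have e2 := T_dist f d hd c (hS (TL f d (W c) ω) ψ' (S_TL _ hω) hψ') x
    have e3 : T f d b (TL f d (W b) ω) x = T f d c (TL f d (W c) ω) x :=
      congrFun (hW b c ω) x
    have e4 := abs_sub_le (T f d b φ' x) (T f d b (TL f d (W b) ω) x) (T f d c ψ' x)
    rw [← e3] at e2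
    rw [abs_sub_comm] at e1
    linarith
  have key : ∀ n : ℕ, ∀ φ ψ, S f d h φ → S f d h ψ → ∀ x, |φ x - ψ x| ≤ κ ^ n * (6 * C) := by
    intro n
    induction n with
    | zero =>
      intro φ ψ hφ hψ x
      have e1 := S_bdd hd hh hC hφ true x
      have e2 := S_bdd hd hh hC hψ true x
      rw [abs_sub_comm] at e2
      have := abs_sub_le (φ x) (h true x) (ψ x)
      rw [pow_zero]
      linarith
    | succ n ih =>
      have := H _ (by positivity) ih
      rw [pow_succ', mul_assoc]
      exact this
  exact sub_eq_zero.mp (zero_of_le_pow h0 h1 fun n => key n _ _ (S.base b) (S.base c) x)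

theorem height_zero {f : X → X} {d : ℝ} {h : X → ℝ} (hd : 2 ≤ d)
    (hh : ∀ x, h (f x) = d * h x) {B : ℝ} (hB : ∀ x, |h x| ≤ B) (x : X) : h x = 0 := by
  refine zero_of_le_pow (κ := 1 / 2) (B := B) (by norm_num) (by norm_num) fun n => ?_
  induction n generalizing x with
  | zero => simpa using hB x
  | succ n ih =>
    have := div_bd hd (ih (f x))
    rw [hh, mul_div_cancel_left₀ _ (by linarith)] at this
    rw [pow_succ]
    linarith

theorem D_eq {f : Bool → X → X} {d : Bool → ℝ} {h : Bool → X → ℝ}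
    (hd : ∀ b, 2 ≤ d b) (hh : ∀ b x, h b (f b x) = d b * h b x) {C : ℝ}
    (hC : ∀ b c x, |h b x - h c x| ≤ C) (hne : h true ≠ h false)
    {L M : List Bool} (hG : G f L = G f M) : D d L = D d M := by
  by_contra hD
  apply hne
  have hz : ∀ b x, h b x = 0 := by
    intro b
    have hpos : 0 < |D d L - D d M| := abs_pos.mpr (sub_ne_zero.mpr hD)
    refine height_zero (hd b) (hh b)
      (B := (D d L + D d M) * (3 * C) / |D d L - D d M|) fun x => ?_
    have e1 := S_bdd hd hh hC (S_TL (d := d) (f := f) L (S.base b)) b x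
    have e2 := S_bdd hd hh hC (S_TL (d := d) (f := f) M (S.base b)) b x
    rw [TL_eq] at e1 e2
    rw [hG] at e1
    have p1 := D_ge d hd L
    have p2 := D_ge d hd M
    rw [le_div_iff₀ hpos, ← abs_mul]
    set y := h b (G f M x)
    have q1 : D d L * (y / D d L) = y := by field_simp
    have q2 : D d M * (y / D d M) = y := by field_simp
    have : h b x * (D d L - D d M) =
        D d M * (y / D d M - h b x) - D d L * (y / D d L - h b x) := by
      linear_combination q1 - q2
    rw [this]
    refine (abs_sub _ _).trans ?_
    rw [abs_mul, abs_mul, abs_of_pos (by linarith : 0 < D d L),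
      abs_of_pos (by linarith : 0 < D d M)]
    nlinarith
  funext x
  rw [hz, hz]

theorem G_inj {f : Bool → X → X} {d : Bool → ℝ} {h : Bool → X → ℝ}
    (hs : ∀ b, Function.Surjective (f b))
    (hd : ∀ b, 2 ≤ d b) (hh : ∀ b x, h b (f b x) = d b * h b x) {C : ℝ}
    (hC : ∀ b c x, |h b x - h c x| ≤ C) (hne : h true ≠ h false)
    (L M : List Bool) (hG : G f L = G f M) : L = M := by
  induction L generalizing M with
  | nil =>
    cases M with
    | nil => rfl
    | cons c M =>
      have := D_eq hd hh hC hne hG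
      simp only [D] at this
      nlinarith [D_ge d hd M, hd c]
  | cons b L ih =>
    cases M with
    | nil =>
      have := D_eq hd hh hC hne hG
      simp only [D] at this
      nlinarith [D_ge d hd L, hd b]
    | cons c M =>
      by_cases hbc : b = c
      · subst hbc
        rw [ih M ((hs b).injective_comp_right hG)]
      · exfalso
        have hDD := D_eq hd hh hC hne hG
        have e : ∀ φ, TL f d (b :: L) φ = TL f d (c :: M) φ := by
          intro φ
          funext x
          rw [TL_eq, TL_eq, hG, hDD]
        apply hne
        refine heights_eq hd hh hC (fun a => if a = b then L else M) ?_ true false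
        have hc : ∀ a, a ≠ b → a = c := by
          intro a ha
          cases a <;> cases b <;> cases c <;> simp_all
        have e' : ∀ a φ, TL f d (a :: (if a = b then L else M)) φ = TL f d (b :: L) φ := by
          intro a φ
          by_cases ha : a = b
          · simp [ha]
          · rw [if_neg ha, e, hc a ha]
        intro a a' φ
        exact (e' a φ).trans (e' a' φ).symm

theorem G_append (f : Bool → X → X) (L : List Bool) (b : Bool) :
    G f (L ++ [b]) = f b ∘ G f L := by
  induction L with
  | nil => rfl
  | cons c L ih => simp only [List.cons_append, G, ih]; rfl

theorem fold_eq (f : Bool → X → X) (w : List Bool) :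
    (w.map f).foldr (· ∘ ·) id = G f w.reverse := by
  induction w with
  | nil => rfl
  | cons b w ih => rw [List.reverse_cons, G_append, ← ih]; rfl

end FreeSemi

/-- Abstract core of Theorem 1: two surjective maps `f₁, f₂` admitting "canonical
heights" `h₁, h₂` (with `hᵢ ∘ fᵢ = dᵢ · hᵢ` for integers `dᵢ ≥ 2`) whose difference
is bounded but which are not equal generate a free semigroup of rank 2. -/
theorem stmt_13 {X : Type*} (f₁ f₂ : X → X)
    (hsurj₁ : Function.Surjective f₁) (hsurj₂ : Function.Surjective f₂)
    (d₁ d₂ : ℤ) (hd₁ : 2 ≤ d₁) (hd₂ : 2 ≤ d₂)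
    (h₁ h₂ : X → ℝ)
    (hh₁ : ∀ x : X, h₁ (f₁ x) = (d₁ : ℝ) * h₁ x)
    (hh₂ : ∀ x : X, h₂ (f₂ x) = (d₂ : ℝ) * h₂ x)
    (hbdd : ∃ C : ℝ, ∀ x : X, |h₁ x - h₂ x| ≤ C)
    (hne : h₁ ≠ h₂) :
    ∀ w₁ w₂ : List Bool, w₁ ≠ [] → w₂ ≠ [] →
      (w₁.map fun b => if b then f₁ else f₂).foldr (· ∘ ·) id =
        (w₂.map fun b => if b then f₁ else f₂).foldr (· ∘ ·) id →
      w₁ = w₂ := by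
  intro w₁ w₂ _ _ heq
  obtain ⟨C, hC⟩ := hbdd
  rw [FreeSemi.fold_eq, FreeSemi.fold_eq] at heq
  have hC' : ∀ b c : Bool, ∀ x, |(if b then h₁ else h₂) x - (if c then h₁ else h₂) x| ≤ C := by
    intro b c x
    have h0 := (abs_nonneg _).trans (hC x)
    have h1 := hC x
    have h2 := hC x
    rw [abs_sub_comm] at h2
    cases b <;> cases c <;> simp [h0, h1, h2]
  have hd : ∀ b : Bool, (2 : ℝ) ≤ (if b then (d₁ : ℝ) else (d₂ : ℝ)) := by
    intro b
    cases b
    · simpa using (by exact_mod_cast hd₂ : (2 : ℝ) ≤ d₂)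
    · simpa using (by exact_mod_cast hd₁ : (2 : ℝ) ≤ d₁)
  have := FreeSemi.G_inj (f := fun b => if b then f₁ else f₂)
    (d := fun b => if b then (d₁ : ℝ) else (d₂ : ℝ)) (h := fun b => if b then h₁ else h₂)
    (by intro b; cases b <;> simp [hsurj₁, hsurj₂]) hd
    (by intro b x; cases b <;> simp [hh₁, hh₂]) hC' (by simpa using hne) _ _ heq
  exact List.reverse_injective this
end

section
/- Let X be a nonempty set, let f : X → X be a map, let d > 1 be a real number, and let h₀ : X → ℝ be a function such that the function x ↦ h₀(f(x)) − d·h₀(x) is bounded. Then there exists a unique function h : X → ℝ such that h − h₀ is bounded and h(f(x)) = d·h(x) for all x ∈ X. -/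
/-- Existence and uniqueness of the canonical height: if `h₀ ∘ f − d·h₀` is bounded
for some `d > 1`, there is a unique function `h` at bounded distance from `h₀`
satisfying `h ∘ f = d·h`. -/
theorem stmt_15 {X : Type*} [Nonempty X] (f : X → X) (d : ℝ) (hd : 1 < d)
    (h₀ : X → ℝ) (hbdd : ∃ C : ℝ, ∀ x : X, |h₀ (f x) - d * h₀ x| ≤ C) :
    ∃! h : X → ℝ, (∃ C : ℝ, ∀ x : X, |h x - h₀ x| ≤ C) ∧
      ∀ x : X, h (f x) = d * h x := by
  obtain ⟨C, hC⟩ := hbdd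
  have hd0 : 0 < d := by linarith
  have hr0 : 0 ≤ d⁻¹ := by positivity
  have hr1 : d⁻¹ < 1 := inv_lt_one_of_one_lt₀ hd
  let g : X → ℝ := fun x => h₀ (f x) - d * h₀ x
  have hgeo : Summable (fun n : ℕ => C * (d⁻¹) ^ n) :=
    (summable_geometric_of_lt_one hr0 hr1).mul_left C
  have hb : ∀ x (n : ℕ), ‖(d⁻¹) ^ n * g (f^[n] x)‖ ≤ C * (d⁻¹) ^ n := by
    intro x n
    rw [norm_mul, Real.norm_eq_abs, Real.norm_eq_abs, abs_of_nonneg (pow_nonneg hr0 n), mul_comm]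
    exact mul_le_mul_of_nonneg_right (hC _) (pow_nonneg hr0 n)
  have hs : ∀ x, Summable (fun n : ℕ => (d⁻¹) ^ n * g (f^[n] x)) := fun x =>
    Summable.of_norm_bounded hgeo (hb x)
  let S : X → ℝ := fun x => ∑' n : ℕ, (d⁻¹) ^ n * g (f^[n] x)
  have hS : ∀ x, S x = g x + d⁻¹ * S (f x) := by
    intro x
    have h1 := (hs x).tsum_eq_zero_add
    have h2 : ∑' n : ℕ, (d⁻¹) ^ (n + 1) * g (f^[n + 1] x) = d⁻¹ * S (f x) := by
      rw [← tsum_mul_left]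
      refine tsum_congr fun n => ?_
      rw [Function.iterate_succ_apply, pow_succ]
      ring
    rw [h2] at h1
    rw [pow_zero, one_mul, Function.iterate_zero_apply] at h1
    exact h1
  refine ⟨fun x => h₀ x + d⁻¹ * S x, ⟨⟨d⁻¹ * ∑' n : ℕ, C * (d⁻¹) ^ n, ?_⟩, ?_⟩, ?_⟩
  · intro x
    have h1 : ‖S x‖ ≤ ∑' n : ℕ, C * (d⁻¹) ^ n := tsum_of_norm_bounded hgeo.hasSum (hb x)
    rw [Real.norm_eq_abs] at h1
    rw [add_sub_cancel_left, abs_mul, abs_of_nonneg hr0]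
    exact mul_le_mul_of_nonneg_left h1 hr0
  · intro x
    have h1 : S x = h₀ (f x) - d * h₀ x + d⁻¹ * S (f x) := hS x
    have h2 : d * (d⁻¹ * S x) = S x := mul_inv_cancel_left₀ hd0.ne' _
    change h₀ (f x) + d⁻¹ * S (f x) = d * (h₀ x + d⁻¹ * S x)
    rw [mul_add, h2]
    linarith
  · -- uniqueness: a bounded solution of the homogeneous equation vanishes
    have huniq : ∀ k : X → ℝ, (∃ B : ℝ, ∀ x, |k x| ≤ B) → (∀ x, k (f x) = d * k x) →
        ∀ x, k x = 0 := by
      rintro k ⟨B, hB⟩ hk x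
      have hit : ∀ n : ℕ, k (f^[n] x) = d ^ n * k x := by
        intro n
        induction n with
        | zero => simp
        | succ n ih => rw [Function.iterate_succ_apply', hk, ih, pow_succ]; ring
      by_contra hne
      have hpos : 0 < |k x| := abs_pos.mpr hne
      obtain ⟨n, hn⟩ := pow_unbounded_of_one_lt (B / |k x|) hd
      have h1 := hB (f^[n] x)
      rw [hit, abs_mul, abs_of_nonneg (pow_nonneg hd0.le n)] at h1
      rw [div_lt_iff₀ hpos] at hn
      linarith
    rintro h ⟨⟨B, hB⟩, hf⟩
    have hB2 : ∀ x, |S x| ≤ ∑' n : ℕ, C * (d⁻¹) ^ n := fun x =>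
      tsum_of_norm_bounded hgeo.hasSum (hb x)
    funext x
    refine sub_eq_zero.mp (huniq (fun x => h x - (h₀ x + d⁻¹ * S x))
      ⟨B + d⁻¹ * ∑' n : ℕ, C * (d⁻¹) ^ n, fun y => ?_⟩ (fun y => ?_) x)
    · have e : h y - (h₀ y + d⁻¹ * S y) = (h y - h₀ y) - d⁻¹ * S y := by ring
      simp only [e]
      refine (norm_sub_le (h y - h₀ y) (d⁻¹ * S y)).trans (add_le_add (hB y) ?_)
      rw [norm_mul, Real.norm_eq_abs, Real.norm_eq_abs, abs_of_nonneg hr0]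
      exact mul_le_mul_of_nonneg_left (hB2 y) hr0
    · have h1 : S y = h₀ (f y) - d * h₀ y + d⁻¹ * S (f y) := hS y
      have h2 : d * (d⁻¹ * S y) = S y := mul_inv_cancel_left₀ hd0.ne' _
      simp only [hf, mul_sub, mul_add, h2]
      linarith
end

section
/- Let n ≥ 1 be an integer and let c ∈ (0,1) be a real number satisfying c + c² + ⋯ + cⁿ = 1. Define α₁, α₂ : ℝ → ℝ by α₁(x) = c·x and α₂(x) = c·x + 1. Then α₁ and α₂ are injective contractions with ratio c, and they satisfy the relation α₁ ∘ α₂ⁿ = α₂ ∘ α₁ⁿ (where α^n denotes n-fold composition); in particular α₁ and α₂ do not generate a free semigroup of rank 2. -/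
theorem iter_mul_aux (c : ℝ) (n : ℕ) (x : ℝ) : (fun x : ℝ => c * x)^[n] x = c ^ n * x := by
  induction n with
  | zero => simp
  | succ k ih => rw [Function.iterate_succ_apply', ih]; ring

theorem iter_affine_aux (c : ℝ) (n : ℕ) (x : ℝ) :
    (fun x : ℝ => c * x + 1)^[n] x = c ^ n * x + ∑ i ∈ Finset.range n, c ^ i := by
  induction n with
  | zero => simp
  | succ k ih =>
    rw [Function.iterate_succ_apply', ih, Finset.sum_range_succ']
    simp only [pow_succ', ← Finset.mul_sum]
    ring

theorem foldr_replicate_aux (f : ℝ → ℝ) (n : ℕ) :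
    (List.replicate n f).foldr (· ∘ ·) id = f^[n] := by
  induction n with
  | zero => rfl
  | succ k ih => rw [List.replicate_succ, List.foldr_cons, ih, Function.iterate_succ']

/-- Sharpness of the bound `c₁ + c₂ ≤ 1`: if `c ∈ (0,1)` satisfies
`c + c² + ⋯ + cⁿ = 1`, then the injective contractions `α₁ : x ↦ c·x` and
`α₂ : x ↦ c·x + 1` of ratio `c` satisfy `α₁ ∘ α₂ⁿ = α₂ ∘ α₁ⁿ`, hence do not
generate a free semigroup of rank 2. -/
theorem stmt_16 (n : ℕ) (hn : 1 ≤ n) (c : ℝ) (hc : c ∈ Set.Ioo (0 : ℝ) 1)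
    (hsum : ∑ i ∈ Finset.range n, c ^ (i + 1) = 1) :
    Function.Injective (fun x : ℝ => c * x) ∧
    Function.Injective (fun x : ℝ => c * x + 1) ∧
    (∀ x y : ℝ, |(fun x : ℝ => c * x) x - (fun x : ℝ => c * x) y| ≤ c * |x - y|) ∧
    (∀ x y : ℝ, |(fun x : ℝ => c * x + 1) x - (fun x : ℝ => c * x + 1) y| ≤ c * |x - y|) ∧
    (fun x : ℝ => c * x) ∘ (fun x : ℝ => c * x + 1)^[n] =
      (fun x : ℝ => c * x + 1) ∘ (fun x : ℝ => c * x)^[n] ∧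
    ∃ w₁ w₂ : List Bool, w₁ ≠ w₂ ∧ w₁ ≠ [] ∧ w₂ ≠ [] ∧
      (w₁.map fun b => if b then (fun x : ℝ => c * x) else fun x : ℝ => c * x + 1).foldr
          (· ∘ ·) id =
        (w₂.map fun b => if b then (fun x : ℝ => c * x) else fun x : ℝ => c * x + 1).foldr
          (· ∘ ·) id := by
  obtain ⟨h0, h1⟩ := hc
  have hrel : (fun x : ℝ => c * x) ∘ (fun x : ℝ => c * x + 1)^[n] =
      (fun x : ℝ => c * x + 1) ∘ (fun x : ℝ => c * x)^[n] := by
    funext x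
    simp only [Function.comp_apply, iter_mul_aux, iter_affine_aux]
    simp only [pow_succ', ← Finset.mul_sum] at hsum
    rw [mul_add, hsum]
  refine ⟨fun x y h => mul_left_cancel₀ h0.ne' h,
    fun x y h => mul_left_cancel₀ h0.ne' (add_right_cancel h), ?_, ?_, hrel,
    true :: List.replicate n false, false :: List.replicate n true, by simp, by simp, by simp, ?_⟩
  · intro x y
    simp only [← mul_sub, abs_mul, abs_of_pos h0, le_refl]
  · intro x y
    simp only [add_sub_add_right_eq_sub, ← mul_sub, abs_mul, abs_of_pos h0, le_refl]
  · simp only [List.map_cons, List.map_replicate, List.foldr_cons, foldr_replicate_aux]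
    simpa using hrel
end

section
/- Let S be a semigroup, let F ⊆ S be a nonempty finite subset, and let Δ ≥ 1 be an integer such that the set F ∪ F² ∪ ⋯ ∪ F^Δ contains two elements a, b generating a free semigroup of rank 2. Then for every integer n ≥ 1 the cardinality of F ∪ F² ∪ ⋯ ∪ F^{nΔ} is at least 2ⁿ. Consequently, liminf_{m → ∞} (1/m)·log #(F ∪ F² ∪ ⋯ ∪ F^m) ≥ log(2)/Δ. -/
/-- The product `a * x₁ * ⋯ * xₖ` of a nonempty list of elements of a semigroup,
given as a head `a` and a tail list. -/
def semigroupWordProd {S : Type*} [Semigroup S] : S → List S → S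
  | a, [] => a
  | a, b :: l => a * semigroupWordProd b l

/-- `ballOfGen F m` is the set `F ∪ F² ∪ ⋯ ∪ F^m`: all products of at least one and
at most `m` elements of `F`. -/
def ballOfGen {S : Type*} [Semigroup S] (F : Finset S) (m : ℕ) : Set S :=
  { s | ∃ (a : S) (l : List S), a ∈ F ∧ (∀ x ∈ l, x ∈ F) ∧ l.length + 1 ≤ m ∧
      semigroupWordProd a l = s }

/-- Two elements `a, b` of a semigroup generate a free semigroup of rank 2:
distinct nonempty words in `a, b` (encoded by a head letter and a tail of letters)
represent distinct elements. -/
def IsFreePair {S : Type*} [Semigroup S] (a b : S) : Prop :=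
  ∀ (x y : Bool) (u v : List Bool),
    semigroupWordProd (if x then a else b) (u.map fun i => if i then a else b) =
      semigroupWordProd (if y then a else b) (v.map fun i => if i then a else b) →
    x = y ∧ u = v

theorem swp_append {S : Type*} [Semigroup S] (l : List S) : ∀ (a b : S) (l' : List S),
    semigroupWordProd a l * semigroupWordProd b l' = semigroupWordProd a (l ++ b :: l') := by
  induction l with
  | nil => intro a b l'; rfl
  | cons c l ih =>
    intro a b l'
    simp only [semigroupWordProd, List.cons_append, mul_assoc, ih]

theorem ballOfGen_mul_mem {S : Type*} [Semigroup S] (F : Finset S) {m k : ℕ} {s t : S}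
    (hs : s ∈ ballOfGen F m) (ht : t ∈ ballOfGen F k) : s * t ∈ ballOfGen F (m + k) := by
  obtain ⟨a, l, ha, hl, hm, rfl⟩ := hs
  obtain ⟨b, l', hb, hl', hk, rfl⟩ := ht
  refine ⟨a, l ++ b :: l', ha, ?_, ?_, (swp_append l a b l').symm⟩
  · intro x hx
    rcases List.mem_append.1 hx with h | h
    · exact hl x h
    · rcases List.mem_cons.1 h with h | h
      · exact h ▸ hb
      · exact hl' x h
  · simp only [List.length_append, List.length_cons]; omega

theorem ball_mono {S : Type*} [Semigroup S] (F : Finset S) {m k : ℕ} (h : m ≤ k) :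
    ballOfGen F m ⊆ ballOfGen F k := by
  rintro s ⟨a, l, ha, hl, hm, rfl⟩
  exact ⟨a, l, ha, hl, hm.trans h, rfl⟩

theorem ball_word {S : Type*} [Semigroup S] (F : Finset S) {D : ℕ} (l : List S) :
    ∀ a : S, a ∈ ballOfGen F D → (∀ x ∈ l, x ∈ ballOfGen F D) →
      semigroupWordProd a l ∈ ballOfGen F ((l.length + 1) * D) := by
  induction l with
  | nil => intro a ha _; simpa [semigroupWordProd] using ha
  | cons c l ih =>
    intro a ha hl
    have := ballOfGen_mul_mem F ha (ih c (hl c (by simp)) (fun x hx => hl x (by simp [hx])))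
    simp only [semigroupWordProd, List.length_cons]
    convert this using 1
    ring

theorem ball_bound {S : Type*} [Semigroup S] (F : Finset S) (m : ℕ) :
    (ballOfGen F m).Finite ∧ (ballOfGen F m).ncard + 1 ≤ (F.card + 1) ^ m := by
  induction m with
  | zero =>
    have : ballOfGen F 0 = ∅ := by
      ext s; simp [ballOfGen]
    simp [this]
  | succ m ih =>
    obtain ⟨hfin, hc⟩ := ih
    have hsub : ballOfGen F (m + 1) ⊆
        (F : Set S) ∪ (fun p : S × S => p.1 * p.2) '' ((F : Set S) ×ˢ ballOfGen F m) := by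
      rintro s ⟨a, l, ha, hl, hm, rfl⟩
      cases l with
      | nil => exact Or.inl ha
      | cons c l =>
        refine Or.inr ⟨(a, semigroupWordProd c l), ⟨ha, c, l, hl c (by simp),
          fun x hx => hl x (by simp [hx]), ?_, rfl⟩, rfl⟩
        simpa using hm
    have hpf : ((F : Set S) ×ˢ ballOfGen F m).Finite := F.finite_toSet.prod hfin
    have hf2 := F.finite_toSet.union (hpf.image (fun p : S × S => p.1 * p.2))
    refine ⟨hf2.subset hsub, ?_⟩
    have h1 := Set.ncard_le_ncard hsub hf2
    have h2 := Set.ncard_union_le (F : Set S)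
      ((fun p : S × S => p.1 * p.2) '' ((F : Set S) ×ˢ ballOfGen F m))
    have h3 := Set.ncard_image_le (f := fun p : S × S => p.1 * p.2) hpf
    rw [Set.ncard_prod, Set.ncard_coe_finset] at h3
    rw [Set.ncard_coe_finset] at h2
    have h4 : F.card * ((ballOfGen F m).ncard + 1) ≤ F.card * (F.card + 1) ^ m :=
      Nat.mul_le_mul_left _ hc
    have h5 : 1 ≤ (F.card + 1) ^ m := Nat.one_le_pow _ _ (by omega)
    rw [pow_succ]
    nlinarith

theorem ball_lower {S : Type*} [Semigroup S] (F : Finset S) (D : ℕ) (a b : S)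
    (ha : a ∈ ballOfGen F D) (hb : b ∈ ballOfGen F D) (hfree : IsFreePair a b)
    (n : ℕ) (hn : 1 ≤ n) : 2 ^ n ≤ (ballOfGen F (n * D)).ncard := by
  obtain ⟨k, rfl⟩ : ∃ k, n = k + 1 := ⟨n - 1, by omega⟩
  let f : Bool × (Fin k → Bool) → S := fun p =>
    semigroupWordProd (if p.1 then a else b) ((List.ofFn p.2).map fun i => if i then a else b)
  have hinj : Function.Injective f := by
    rintro ⟨x, u⟩ ⟨y, v⟩ h
    obtain ⟨h1, h2⟩ := hfree x y _ _ h
    exact Prod.ext h1 (List.ofFn_injective h2)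
  have hsub : Set.range f ⊆ ballOfGen F ((k + 1) * D) := by
    rintro _ ⟨⟨x, u⟩, rfl⟩
    have key : ∀ i : Bool, (if i then a else b) ∈ ballOfGen F D := by
      intro i; cases i <;> simpa
    have := ball_word F (D := D) ((List.ofFn u).map fun i => if i then a else b)
      (if x then a else b) (key x) (by
        intro y hy
        obtain ⟨i, _, rfl⟩ := List.mem_map.1 hy
        exact key i)
    simpa [f] using this
  have h := Set.ncard_le_ncard hsub (ball_bound F _).1
  rw [← Set.image_univ, Set.ncard_image_of_injective _ hinj, Set.ncard_univ] at h
  simpa [Nat.card_eq_fintype_card, pow_succ, mul_comm] using h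

theorem stmt_18 {S : Type*} [Semigroup S] (F : Finset S) (hF : F.Nonempty)
    (Δ : ℕ) (hΔ : 1 ≤ Δ) (a b : S)
    (ha : a ∈ ballOfGen F Δ) (hb : b ∈ ballOfGen F Δ) (hfree : IsFreePair a b) :
    (∀ n : ℕ, 1 ≤ n → 2 ^ n ≤ (ballOfGen F (n * Δ)).ncard) ∧
    Real.log 2 / (Δ : ℝ) ≤
      Filter.liminf
        (fun m : ℕ => (1 / m : ℝ) * Real.log ((ballOfGen F m).ncard))
        Filter.atTop := by
  have hlow := ball_lower F Δ a b ha hb hfree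
  refine ⟨hlow, ?_⟩
  have hl2 : 0 < Real.log 2 := Real.log_pos (by norm_num)
  have hΔ0 : (0 : ℝ) < Δ := by exact_mod_cast hΔ
  have hcob : Filter.IsCoboundedUnder (· ≥ ·) Filter.atTop
      (fun m : ℕ => (1 / m : ℝ) * Real.log ((ballOfGen F m).ncard)) := by
    apply Filter.IsBoundedUnder.isCoboundedUnder_ge
    refine Filter.isBoundedUnder_of_eventually_le (a := Real.log ((F.card : ℝ) + 1)) ?_
    filter_upwards [Filter.eventually_ge_atTop Δ] with m hm
    have hm0 : (0 : ℝ) < m := by exact_mod_cast (lt_of_lt_of_le hΔ hm)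
    have hpos : 0 < (ballOfGen F m).ncard :=
      (Set.ncard_pos (ball_bound F m).1).2 ⟨a, ball_mono F hm ha⟩
    have h1 : ((ballOfGen F m).ncard : ℝ) ≤ ((F.card : ℝ) + 1) ^ m := by
      exact_mod_cast (Nat.le_succ _).trans (ball_bound F m).2
    have h2 := Real.log_le_log (by exact_mod_cast hpos) h1
    rw [Real.log_pow] at h2
    rw [one_div, inv_mul_le_iff₀ hm0]
    exact h2
  apply le_of_forall_lt
  intro c hc
  obtain ⟨d, hcd, hd⟩ := exists_between hc
  refine lt_of_lt_of_le hcd (Filter.le_liminf_of_le hcob ?_)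
  have ht : Filter.Tendsto (fun m : ℕ => Real.log 2 / (Δ : ℝ) - Real.log 2 / (m : ℝ))
      Filter.atTop (nhds (Real.log 2 / (Δ : ℝ))) := by
    simpa using tendsto_const_nhds.sub (tendsto_const_div_atTop_nhds_zero_nat (Real.log 2))
  filter_upwards [Filter.eventually_ge_atTop Δ, ht.eventually (lt_mem_nhds hd)] with m hm hmd
  refine hmd.le.trans ?_
  have hm0 : (0 : ℝ) < m := by exact_mod_cast (lt_of_lt_of_le hΔ hm)
  have hq : 1 ≤ m / Δ := (Nat.one_le_div_iff hΔ).2 hm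
  have h1 : 2 ^ (m / Δ) ≤ (ballOfGen F m).ncard :=
    (hlow _ hq).trans (Set.ncard_le_ncard (ball_mono F (Nat.div_mul_le_self m Δ))
      (ball_bound F m).1)
  have h2 : ((2 : ℝ)) ^ (m / Δ) ≤ ((ballOfGen F m).ncard : ℝ) := by exact_mod_cast h1
  have h3 := Real.log_le_log (by positivity) h2
  rw [Real.log_pow] at h3
  have h4 : (m : ℝ) / Δ - 1 ≤ ((m / Δ : ℕ) : ℝ) := by
    have h5 : m < (m / Δ + 1) * Δ := by
      rw [mul_comm]; exact Nat.lt_mul_div_succ m hΔ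
    have h6 : (m : ℝ) < (((m / Δ : ℕ) : ℝ) + 1) * Δ := by exact_mod_cast h5
    rw [sub_le_iff_le_add, div_le_iff₀ hΔ0]
    exact h6.le
  have h7 := (mul_le_mul_of_nonneg_right h4 hl2.le).trans h3
  calc Real.log 2 / (Δ : ℝ) - Real.log 2 / (m : ℝ)
      = (1 / m : ℝ) * (((m : ℝ) / Δ - 1) * Real.log 2) := by field_simp
    _ ≤ _ := mul_le_mul_of_nonneg_left h7 (by positivity)
end
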